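/- (Achievability for the main theorem.) For every finite alphabets 𝒳, 𝒴, 𝒵, every source pmf p₀ on 𝒳, every payoff function π : 𝒳 × 𝒴 × 𝒵 → ℝ, and all rates R₀, R ≥ 0, the robust achievable value is at least the single-letter value: Π_{p₀}(R₀,R) ≥ Γ_{p₀,π}(R₀,R). Equivalently, for every finite 𝒰, 𝒱, every p(y,u,v|x) ∈ 𝒫_{p₀}(R₀,R), and every ε > 0, there exist n and an (R₀,R,n) coordination scheme whose average value against every adversary strategy is at least min over functions z : 𝒰 → 𝒵 of E[π(X,Y,z(U))] − ε. -/

import Mathlib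

open scoped BigOperators Classical

noncomputable section

/-! ### Finite probability basics -/

/-- A probability mass function on a finite type, given as a real-valued function. -/
def IsPMF {α : Type} [Fintype α] (p : α → ℝ) : Prop :=
  (∀ a, 0 ≤ p a) ∧ ∑ a, p a = 1

/-- The probability that the random variable `A` takes the value `a` under the pmf `p`. -/
def probOf {Ω : Type} {α : Type} [Fintype Ω] (p : Ω → ℝ) (A : Ω → α) (a : α) : ℝ :=
  ∑ ω, if A ω = a then p ω else 0

/-- Shannon entropy (in bits) of the random variable `A` under the pmf `p`. -/
def entropy {Ω α : Type} [Fintype Ω] [Fintype α] (p : Ω → ℝ) (A : Ω → α) : ℝ :=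
  -∑ a, probOf p A a * Real.logb 2 (probOf p A a)

/-- Conditional Shannon entropy `H(A | C)` (in bits). -/
def condEntropy {Ω α γ : Type} [Fintype Ω] [Fintype α] [Fintype γ]
    (p : Ω → ℝ) (A : Ω → α) (C : Ω → γ) : ℝ :=
  entropy p (fun ω => (A ω, C ω)) - entropy p C

/-- Shannon mutual information `I(A;B)` (in bits). -/
def mutualInfo {Ω α β : Type} [Fintype Ω] [Fintype α] [Fintype β]
    (p : Ω → ℝ) (A : Ω → α) (B : Ω → β) : ℝ :=
  entropy p A + entropy p B - entropy p (fun ω => (A ω, B ω))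

/-- Conditional Shannon mutual information `I(A;B|C)` (in bits). -/
def condMutualInfo {Ω α β γ : Type} [Fintype Ω] [Fintype α] [Fintype β] [Fintype γ]
    (p : Ω → ℝ) (A : Ω → α) (B : Ω → β) (C : Ω → γ) : ℝ :=
  entropy p (fun ω => (A ω, C ω)) + entropy p (fun ω => (B ω, C ω))
    - entropy p (fun ω => (A ω, B ω, C ω)) - entropy p C

/-- Conditional independence `A ⟂ B | C` under the pmf `p`:
`P(A=a, B=b, C=c) · P(C=c) = P(A=a, C=c) · P(B=b, C=c)` for all `a, b, c`. -/
def CondIndep {Ω α β γ : Type} [Fintype Ω] (p : Ω → ℝ)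
    (A : Ω → α) (B : Ω → β) (C : Ω → γ) : Prop :=
  ∀ a b c,
    probOf p (fun ω => (A ω, B ω, C ω)) (a, b, c) * probOf p C c
      = probOf p (fun ω => (A ω, C ω)) (a, c) * probOf p (fun ω => (B ω, C ω)) (b, c)

/-! ### Coordination schemes and adversaries -/

/-- Cardinality of the secret-key alphabet: `max 1 ⌊2^{n R₀}⌋`. -/
def keyCard (R0 : ℝ) (n : ℕ) : ℕ := max 1 ⌊(2 : ℝ) ^ ((n : ℝ) * R0)⌋₊

/-- Cardinality of the message alphabet: `max 1 ⌊2^{n R}⌋`. -/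
def msgCard (R : ℝ) (n : ℕ) : ℕ := max 1 ⌊(2 : ℝ) ^ ((n : ℝ) * R)⌋₊

/-- An `(R₀, R, n)` coordination scheme: a randomized encoder `p(j | xⁿ, k)` and a
randomized causal decoder `{p(yᵢ | j, k, x^{i-1}, y^{i-1}, z^{i-1})}`. -/
structure Scheme (X Y Z : Type) [Fintype X] [Fintype Y] [Fintype Z]
    (R0 R : ℝ) (n : ℕ) where
  enc : (Fin n → X) → Fin (keyCard R0 n) → Fin (msgCard R n) → ℝ
  enc_pmf : ∀ x k, IsPMF (enc x k)
  dec : Fin n → Fin (msgCard R n) → Fin (keyCard R0 n) →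
      (Fin n → X) → (Fin n → Y) → (Fin n → Z) → Y → ℝ
  dec_pmf : ∀ i j k x y z, IsPMF (dec i j k x y z)
  dec_causal : ∀ i j k x y z x' y' z',
      (∀ m, m < i → x m = x' m) → (∀ m, m < i → y m = y' m) →
      (∀ m, m < i → z m = z' m) →
      dec i j k x y z = dec i j k x' y' z'

/-- An adversary strategy with full causal information:
`{p(zᵢ | j, x^{i-1}, y^{i-1}, z^{i-1})}`. -/
structure Adversary (X Y Z : Type) [Fintype X] [Fintype Y] [Fintype Z]
    (R : ℝ) (n : ℕ) where
  adv : Fin n → Fin (msgCard R n) →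
      (Fin n → X) → (Fin n → Y) → (Fin n → Z) → Z → ℝ
  adv_pmf : ∀ i j x y z, IsPMF (adv i j x y z)
  adv_causal : ∀ i j x y z x' y' z',
      (∀ m, m < i → x m = x' m) → (∀ m, m < i → y m = y' m) →
      (∀ m, m < i → z m = z' m) →
      adv i j x y z = adv i j x' y' z'

/-- Sample space of a block of length `n`: `(Xⁿ, K, J, Yⁿ, Zⁿ)`. -/
abbrev Outc (X Y Z : Type) (R0 R : ℝ) (n : ℕ) : Type :=
  (Fin n → X) × Fin (keyCard R0 n) × Fin (msgCard R n) × (Fin n → Y) × (Fin n → Z)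

/-- The induced joint pmf of `(Xⁿ, K, J, Yⁿ, Zⁿ)`:
`p₀ⁿ(xⁿ)·|𝒦|⁻¹·p(j|xⁿ,k)·∏ᵢ p(yᵢ|j,k,x^{i-1},y^{i-1},z^{i-1})·p(zᵢ|j,x^{i-1},y^{i-1},z^{i-1})`. -/
def jointPMF {X Y Z : Type} [Fintype X] [Fintype Y] [Fintype Z] {R0 R : ℝ} {n : ℕ}
    (p0 : X → ℝ) (S : Scheme X Y Z R0 R n) (A : Adversary X Y Z R n) :
    Outc X Y Z R0 R n → ℝ :=
  fun ω => (∏ i, p0 (ω.1 i)) * ((keyCard R0 n : ℝ))⁻¹ *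
    S.enc ω.1 ω.2.1 ω.2.2.1 *
    ∏ i, S.dec i ω.2.2.1 ω.2.1 ω.1 ω.2.2.2.1 ω.2.2.2.2 (ω.2.2.2.1 i) *
      A.adv i ω.2.2.1 ω.1 ω.2.2.2.1 ω.2.2.2.2 (ω.2.2.2.2 i)

/-- The expected average payoff `E[(1/n) Σᵢ π(Xᵢ, Yᵢ, Zᵢ)]`. -/
def avgValue {X Y Z : Type} [Fintype X] [Fintype Y] [Fintype Z] {R0 R : ℝ} {n : ℕ}
    (p0 : X → ℝ) (π : X → Y → Z → ℝ)
    (S : Scheme X Y Z R0 R n) (A : Adversary X Y Z R n) : ℝ :=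
  ∑ ω : Outc X Y Z R0 R n, jointPMF p0 S A ω *
    ((n : ℝ)⁻¹ * ∑ i, π (ω.1 i) (ω.2.2.2.1 i) (ω.2.2.2.2 i))

/-- The robust achievable value `Π_{p₀}(R₀, R)`: the supremum over blocklengths and schemes
of the least average payoff over all (fully informed) adversary strategies. -/
def robustValue {X Y Z : Type} [Fintype X] [Fintype Y] [Fintype Z]
    (p0 : X → ℝ) (π : X → Y → Z → ℝ) (R0 R : ℝ) : ℝ :=
  ⨆ (n : ℕ) (_ : 0 < n) (S : Scheme X Y Z R0 R n),
    ⨅ A : Adversary X Y Z R n, avgValue p0 π S A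

/-! ### Single-letter quantities -/

/-- The single-letter joint pmf of `(X, Y, U, V)` built from the source `p₀` and a
conditional pmf `p(y,u,v|x)`. -/
def slJoint {X Y U V : Type} (p0 : X → ℝ) (w : X → Y × U × V → ℝ) :
    X × Y × U × V → ℝ :=
  fun q => p0 q.1 * w q.1 q.2

/-- Membership in the single-letter region `𝒫_{p₀}(R₀,R)`: `p(y,u,v|x)` is a conditional pmf,
`X — (U,V) — Y` is a Markov chain, `R₀ ≥ I(X,Y;V|U)` and `R ≥ I(X;U,V)`. -/
def memP {X Y U V : Type} [Fintype X] [Fintype Y] [Fintype U] [Fintype V]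
    (p0 : X → ℝ) (w : X → Y × U × V → ℝ) (R0 R : ℝ) : Prop :=
  (∀ x, IsPMF (w x)) ∧
  CondIndep (slJoint p0 w) (fun q => q.1) (fun q => q.2.1) (fun q => q.2.2) ∧
  R0 ≥ condMutualInfo (slJoint p0 w)
      (fun q => (q.1, q.2.1)) (fun q => q.2.2.2) (fun q => q.2.2.1) ∧
  R ≥ mutualInfo (slJoint p0 w) (fun q => q.1) (fun q => q.2.2)

/-- The expected payoff `E[π(X, Y, z(U))]` when the adversary plays a function `z : U → Z`. -/
def slPayoff {X Y Z U V : Type} [Fintype X] [Fintype Y] [Fintype U] [Fintype V]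
    (p0 : X → ℝ) (w : X → Y × U × V → ℝ) (π : X → Y → Z → ℝ) (z : U → Z) : ℝ :=
  ∑ q : X × Y × U × V, slJoint p0 w q * π q.1 q.2.1 (z q.2.2.1)

/-- The single-letter value `Γ_{p₀,π}(R₀,R)`: the supremum over finite auxiliary alphabets
`𝒰, 𝒱` and conditional pmfs `p(y,u,v|x) ∈ 𝒫_{p₀}(R₀,R)` of `min_{z : 𝒰 → 𝒵} E[π(X,Y,z(U))]`. -/
def Gamma {X Y Z : Type} [Fintype X] [Fintype Y] [Fintype Z]
    (p0 : X → ℝ) (π : X → Y → Z → ℝ) (R0 R : ℝ) : ℝ :=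
  sSup {v : ℝ | ∃ (U V : Type) (_ : Fintype U) (_ : Fintype V)
    (w : X → Y × U × V → ℝ), memP p0 w R0 R ∧
    v = ⨅ z : U → Z, slPayoff p0 w π z}

/-! ### Expectations under product distributions -/

lemma sum_pi_prod {ι α : Type} [Fintype ι] [DecidableEq ι] [Fintype α] (f : ι → α → ℝ) :
    ∑ ω : ι → α, ∏ i, f i (ω i) = ∏ i, ∑ a, f i a :=
  (Fintype.prod_sum f).symm

lemma IsPMF.pi {ι α : Type} [Fintype ι] [DecidableEq ι] [Fintype α] {p : ι → α → ℝ} (hp : ∀ i, IsPMF (p i)) :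
    IsPMF (fun ω : ι → α => ∏ i, p i (ω i)) :=
  ⟨fun ω => Finset.prod_nonneg fun i _ => (hp i).1 _, by
    rw [sum_pi_prod]; exact Finset.prod_eq_one fun i _ => (hp i).2⟩

/-- The expectation of a function of one coordinate under a product distribution. -/
lemma sum_pi_prod_mul_eval {ι α : Type} [Fintype ι] [DecidableEq ι] [Fintype α] {p : ι → α → ℝ}
    (hp : ∀ i, ∑ a, p i a = 1) (i₀ : ι) (F : α → ℝ) :
    ∑ ω : ι → α, (∏ i, p i (ω i)) * F (ω i₀) = ∑ a, p i₀ a * F a := by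
  have h : ∀ ω : ι → α, (∏ i, p i (ω i)) * F (ω i₀)
      = ∏ i, p i (ω i) * (if i = i₀ then F (ω i) else 1) := by
    intro ω
    rw [Finset.prod_mul_distrib, Finset.prod_ite_eq' Finset.univ i₀ (fun i => F (ω i))]
    simp
  simp_rw [h]
  rw [sum_pi_prod (fun i a => p i a * (if i = i₀ then F a else 1)),
    Finset.prod_eq_single i₀]
  · simp
  · intro b _ hb
    simp [hb, hp]
  · simp

/-- Distinct coordinates are uncorrelated under a product distribution. -/
lemma sum_pi_prod_mul_eval_mul_eval {ι α : Type} [Fintype ι] [DecidableEq ι] [Fintype α] {p g : α → ℝ}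
    (hg : ∑ a, p a * g a = 0) {i₀ i₁ : ι} (hne : i₀ ≠ i₁) :
    ∑ ω : ι → α, (∏ i, p (ω i)) * (g (ω i₀) * g (ω i₁)) = 0 := by
  have h : ∀ ω : ι → α, (∏ i, p (ω i)) * (g (ω i₀) * g (ω i₁))
      = ∏ i, p (ω i) * ((if i = i₀ then g (ω i) else 1) * (if i = i₁ then g (ω i) else 1)) := by
    intro ω
    rw [Finset.prod_mul_distrib, Finset.prod_mul_distrib,
      Finset.prod_ite_eq' Finset.univ i₀ (fun i => g (ω i)),
      Finset.prod_ite_eq' Finset.univ i₁ (fun i => g (ω i))]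
    simp
  simp_rw [h]
  rw [sum_pi_prod (fun i a => p a * ((if i = i₀ then g a else 1) * (if i = i₁ then g a else 1)))]
  apply Finset.prod_eq_zero (Finset.mem_univ i₀)
  simp [hne, hg]

/-- The second moment of a sum of i.i.d. centred random variables. -/
lemma sum_pi_prod_mul_sq_sum {ι α : Type} [Fintype ι] [DecidableEq ι] [Fintype α] {p g : α → ℝ}
    (hp : ∑ a, p a = 1) (hg : ∑ a, p a * g a = 0) :
    ∑ ω : ι → α, (∏ i, p (ω i)) * (∑ i, g (ω i)) ^ 2
      = (Fintype.card ι : ℝ) * ∑ a, p a * g a ^ 2 := by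
  have h : ∀ ω : ι → α, (∏ i, p (ω i)) * (∑ i, g (ω i)) ^ 2
      = ∑ i, ∑ j, (∏ i, p (ω i)) * (g (ω i) * g (ω j)) := by
    intro ω
    rw [sq, Finset.sum_mul_sum, Finset.mul_sum]
    exact Finset.sum_congr rfl fun i _ => Finset.mul_sum _ _ _
  simp_rw [h]
  rw [Finset.sum_comm]
  have h2 : ∀ i : ι, ∑ ω : ι → α, ∑ j, (∏ i, p (ω i)) * (g (ω i) * g (ω j))
      = ∑ a, p a * g a ^ 2 := by
    intro i
    rw [Finset.sum_comm, Finset.sum_eq_single i]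
    · have := sum_pi_prod_mul_eval (p := fun _ : ι => p) (fun _ => hp) i (fun a => g a ^ 2)
      simpa [sq] using this
    · intro j _ hj
      exact sum_pi_prod_mul_eval_mul_eval hg hj.symm
    · simp
  simp [h2]

lemma IsPMF.sum_mul_abs_le_sqrt {α : Type} [Fintype α] {p : α → ℝ} (hp : IsPMF p) (g : α → ℝ) :
    ∑ a, p a * |g a| ≤ √(∑ a, p a * g a ^ 2) := by
  apply Real.le_sqrt_of_sq_le
  have := Finset.sum_sq_le_sum_mul_sum_of_sq_le_mul Finset.univ
    (r := fun a => p a * |g a|) (f := p) (g := fun a => p a * g a ^ 2)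
    (fun a _ => hp.1 a) (fun a _ => mul_nonneg (hp.1 a) (sq_nonneg _))
    (fun a _ => by rw [mul_pow, sq_abs]; apply le_of_eq; ring)
  rwa [hp.2, one_mul] at this

lemma IsPMF.exists_le_of_le_sum {α : Type} [Fintype α] {p : α → ℝ} (hp : IsPMF p) {G : α → ℝ}
    {v : ℝ} (h : v ≤ ∑ a, p a * G a) : ∃ a, v ≤ G a := by
  by_contra! hc
  have h1 : ∑ a, p a * G a < ∑ a, p a * v := by
    apply Finset.sum_lt_sum
    · exact fun a _ => mul_le_mul_of_nonneg_left (hc a).le (hp.1 a)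
    · have : ∃ a ∈ Finset.univ, 0 < p a := by
        apply Finset.exists_lt_of_sum_lt (f := fun _ => (0 : ℝ))
        simp [hp.2]
      obtain ⟨a, ha, hpa⟩ := this
      exact ⟨a, ha, mul_lt_mul_of_pos_left (hc a) hpa⟩
  rw [← Finset.sum_mul, hp.2, one_mul] at h1
  linarith

/-- The mean absolute deviation of an average of i.i.d. random variables. -/
lemma sum_pi_prod_mul_abs_avg_sub_le {ι α : Type} [Fintype ι] [DecidableEq ι] [Nonempty ι] [Fintype α]
    {p : α → ℝ} (hp : IsPMF p) (f : α → ℝ) :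
    ∑ ω : ι → α, (∏ i, p (ω i)) * |(Fintype.card ι : ℝ)⁻¹ * ∑ i, f (ω i) - ∑ a, p a * f a|
      ≤ √((Fintype.card ι : ℝ)⁻¹ * ∑ a, p a * f a ^ 2) := by
  set N : ℝ := (Fintype.card ι : ℝ) with hN
  have hNpos : 0 < N := by rw [hN]; exact_mod_cast Fintype.card_pos
  set m := ∑ a, p a * f a with hm
  have hg : ∑ a, p a * (f a - m) = 0 := by
    simp_rw [mul_sub]
    rw [Finset.sum_sub_distrib, ← Finset.sum_mul, hp.2, ← hm]; ring
  refine ((IsPMF.pi (fun _ : ι => hp)).sum_mul_abs_le_sqrt _).trans (Real.sqrt_le_sqrt ?_)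
  have h1 : ∀ ω : ι → α, (∏ i, p (ω i)) * (N⁻¹ * ∑ i, f (ω i) - m) ^ 2
      = N⁻¹ ^ 2 * ((∏ i, p (ω i)) * (∑ i, (f (ω i) - m)) ^ 2) := by
    intro ω
    rw [Finset.sum_sub_distrib]
    simp only [Finset.sum_const, Finset.card_univ, nsmul_eq_mul, ← hN]
    field_simp
  simp_rw [h1]
  rw [← Finset.mul_sum, sum_pi_prod_mul_sq_sum hp.2 hg, ← hN]
  have h2 : ∑ a, p a * (f a - m) ^ 2 ≤ ∑ a, p a * f a ^ 2 := by
    have : ∑ a, p a * (f a - m) ^ 2 = ∑ a, p a * f a ^ 2 - m ^ 2 := by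
      have h : ∀ a, p a * (f a - m) ^ 2 = p a * f a ^ 2 - 2 * m * (p a * f a) + m ^ 2 * p a := by
        intro a; ring
      simp_rw [h]
      rw [Finset.sum_add_distrib, Finset.sum_sub_distrib, ← Finset.mul_sum, ← Finset.mul_sum,
        ← hm, hp.2]
      ring
    nlinarith [sq_nonneg m]
  calc N⁻¹ ^ 2 * (N * ∑ a, p a * (f a - m) ^ 2) = N⁻¹ * ∑ a, p a * (f a - m) ^ 2 := by
        field_simp
    _ ≤ _ := mul_le_mul_of_nonneg_left h2 (inv_nonneg.2 hNpos.le)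

/-- One-shot soft covering: the output distribution of a channel `W` driven by a uniformly chosen
codeword of a random i.i.d. codebook is close to the output distribution `o` in expected total
variation. -/
lemma soft_covering {ι C B : Type} [Fintype ι] [DecidableEq ι] [Nonempty ι] [Fintype C] [Fintype B]
    {P : C → ℝ} (hP : IsPMF P) {W : C → B → ℝ} (hW : ∀ c, IsPMF (W c)) {o : B → ℝ}
    (ho : ∀ b, o b = ∑ c, P c * W c b) {T : ℝ} (hT : 0 ≤ T) :
    ∑ ω : ι → C, (∏ i, P (ω i)) * ∑ b, |(Fintype.card ι : ℝ)⁻¹ * ∑ i, W (ω i) b - o b|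
      ≤ 2 * ∑ c, P c * ∑ b, (if T * o b < W c b then W c b else 0)
        + √((Fintype.card ι : ℝ)⁻¹ * T) := by
  set N : ℝ := (Fintype.card ι : ℝ) with hN
  have hNpos : 0 < N := by rw [hN]; exact_mod_cast Fintype.card_pos
  set W1 : C → B → ℝ := fun c b => if T * o b < W c b then 0 else W c b with hW1
  set W2 : C → B → ℝ := fun c b => if T * o b < W c b then W c b else 0 with hW2
  have hsplit : ∀ c b, W c b = W1 c b + W2 c b := by
    intro c b; simp only [hW1, hW2]; split_ifs <;> simp
  have hW2nn : ∀ c b, 0 ≤ W2 c b := by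
    intro c b; simp only [hW2]; split_ifs
    · exact (hW c).1 b
    · exact le_rfl
  have honn : ∀ b, 0 ≤ o b := fun b => by
    rw [ho]; exact Finset.sum_nonneg fun c _ => mul_nonneg (hP.1 c) ((hW c).1 b)
  have hosum : ∑ b, o b = 1 := by
    simp_rw [ho]
    rw [Finset.sum_comm]
    simp_rw [← Finset.mul_sum, (hW _).2, mul_one, hP.2]
  have hPi := IsPMF.pi (fun _ : ι => hP)
  have key : ∀ b, ∑ ω : ι → C, (∏ i, P (ω i)) * |N⁻¹ * ∑ i, W (ω i) b - o b|
      ≤ o b * √(N⁻¹ * T) + 2 * ∑ c, P c * W2 c b := by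
    intro b
    have h1 : ∀ ω : ι → C, (∏ i, P (ω i)) * |N⁻¹ * ∑ i, W (ω i) b - o b|
        ≤ (∏ i, P (ω i)) * |N⁻¹ * ∑ i, W1 (ω i) b - ∑ c, P c * W1 c b|
          + (N⁻¹ * ∑ i, (∏ i, P (ω i)) * W2 (ω i) b
          + (∏ i, P (ω i)) * ∑ c, P c * W2 c b) := by
      intro ω
      rw [← Finset.mul_sum]
      have hS : 0 ≤ N⁻¹ * ∑ i, W2 (ω i) b :=
        mul_nonneg (inv_nonneg.2 hNpos.le) (Finset.sum_nonneg fun i _ => hW2nn _ _)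
      have hS' : 0 ≤ ∑ c, P c * W2 c b :=
        Finset.sum_nonneg fun c _ => mul_nonneg (hP.1 c) (hW2nn _ _)
      have : |N⁻¹ * ∑ i, W (ω i) b - o b| ≤ |N⁻¹ * ∑ i, W1 (ω i) b - ∑ c, P c * W1 c b|
          + (N⁻¹ * ∑ i, W2 (ω i) b + ∑ c, P c * W2 c b) := by
        have e : N⁻¹ * ∑ i, W (ω i) b - o b = (N⁻¹ * ∑ i, W1 (ω i) b - ∑ c, P c * W1 c b)
            + (N⁻¹ * ∑ i, W2 (ω i) b - ∑ c, P c * W2 c b) := by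
          rw [ho]
          simp_rw [hsplit, mul_add, Finset.sum_add_distrib]
          ring
        rw [e]
        refine (abs_add_le _ _).trans ?_
        gcongr
        refine (abs_sub _ _).trans ?_
        rw [abs_of_nonneg hS, abs_of_nonneg hS']
      have := mul_le_mul_of_nonneg_left this (hPi.1 ω)
      refine this.trans (le_of_eq ?_)
      ring
    refine (Finset.sum_le_sum fun ω _ => h1 ω).trans ?_
    rw [Finset.sum_add_distrib, Finset.sum_add_distrib, ← Finset.mul_sum, ← Finset.sum_mul,
      hPi.2, Finset.sum_comm]
    have h2 : ∀ i : ι, ∑ ω : ι → C, (∏ i, P (ω i)) * W2 (ω i) b = ∑ c, P c * W2 c b :=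
      fun i => sum_pi_prod_mul_eval (p := fun _ => P) (fun _ => hP.2) i (fun c => W2 c b)
    simp_rw [h2]
    simp only [Finset.sum_const, Finset.card_univ, nsmul_eq_mul, ← hN]
    have h3 : N⁻¹ * (N * ∑ c, P c * W2 c b) = ∑ c, P c * W2 c b := by field_simp
    rw [h3]
    have h4 := sum_pi_prod_mul_abs_avg_sub_le (ι := ι) hP (fun c => W1 c b)
    rw [← hN] at h4
    have h5 : √(N⁻¹ * ∑ a, P a * W1 a b ^ 2) ≤ o b * √(N⁻¹ * T) := by
      rw [← Real.sqrt_sq (honn b), ← Real.sqrt_mul (sq_nonneg _)]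
      apply Real.sqrt_le_sqrt
      have : ∑ a, P a * W1 a b ^ 2 ≤ T * o b * o b := by
        nth_rw 2 [ho]
        rw [Finset.mul_sum]
        apply Finset.sum_le_sum
        intro c _
        have hc : W1 c b ^ 2 ≤ T * o b * W c b := by
          simp only [hW1]
          split_ifs with h
          · have := mul_nonneg (mul_nonneg hT (honn b)) ((hW c).1 b)
            simpa using this
          · rw [sq]
            exact mul_le_mul_of_nonneg_right (not_lt.1 h) ((hW c).1 b)
        have := mul_le_mul_of_nonneg_left hc (hP.1 c)
        linarith
      have := mul_le_mul_of_nonneg_left this (inv_nonneg.2 hNpos.le)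
      refine this.trans (le_of_eq ?_)
      ring
    linarith
  calc ∑ ω : ι → C, (∏ i, P (ω i)) * ∑ b, |N⁻¹ * ∑ i, W (ω i) b - o b|
      = ∑ b, ∑ ω : ι → C, (∏ i, P (ω i)) * |N⁻¹ * ∑ i, W (ω i) b - o b| := by
        simp_rw [Finset.mul_sum]
        rw [Finset.sum_comm]
    _ ≤ ∑ b, (o b * √(N⁻¹ * T) + 2 * ∑ c, P c * W2 c b) := Finset.sum_le_sum fun b _ => key b
    _ = _ := by
        rw [Finset.sum_add_distrib, ← Finset.sum_mul, hosum, one_mul, ← Finset.mul_sum,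
          Finset.sum_comm, add_comm]
        simp_rw [← Finset.mul_sum]
        rfl

/-- If every codeword of positive probability induces the output distribution `o` exactly, then the
soft covering error vanishes. -/
lemma soft_covering_of_forall_eq {ι C B : Type} [Fintype ι] [DecidableEq ι] [Nonempty ι] [Fintype C] [Fintype B]
    {P : C → ℝ} (hP : IsPMF P) {W : C → B → ℝ} {o : B → ℝ}
    (h : ∀ c, 0 < P c → ∀ b, W c b = o b) :
    ∑ ω : ι → C, (∏ i, P (ω i)) * ∑ b, |(Fintype.card ι : ℝ)⁻¹ * ∑ i, W (ω i) b - o b| = 0 := by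
  apply Finset.sum_eq_zero
  intro ω _
  by_cases hω : ∏ i, P (ω i) = 0
  · simp [hω]
  · have hpos : ∀ i, 0 < P (ω i) := fun i =>
      lt_of_le_of_ne (hP.1 _) (fun h0 => hω (Finset.prod_eq_zero (Finset.mem_univ i) h0.symm))
    have : ∀ b, |(Fintype.card ι : ℝ)⁻¹ * ∑ i, W (ω i) b - o b| = 0 := by
      intro b
      simp_rw [fun i => h _ (hpos i) b]
      simp
    simp [this]

/-- Chebyshev's inequality for the information density of a product distribution. -/
lemma sum_pi_prod_ite_lt_le {α : Type} [Fintype α] {p f g : α → ℝ} (hp : IsPMF p)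
    (hf : ∀ a, 0 < p a → 0 < f a) (hg : ∀ a, 0 < p a → 0 < g a) {γ : ℝ}
    (hγ : ∑ a, p a * Real.logb 2 (f a / g a) < γ) :
    ∃ c : ℝ, ∀ n : ℕ, 0 < n →
      ∑ ω : Fin n → α, (if (2 : ℝ) ^ ((n : ℝ) * γ) * ∏ i, g (ω i) < ∏ i, f (ω i)
        then ∏ i, p (ω i) else 0) ≤ c / n := by
  set μ := ∑ a, p a * Real.logb 2 (f a / g a) with hμ
  set h : α → ℝ := fun a => Real.logb 2 (f a / g a) - μ with hh
  have hmean : ∑ a, p a * h a = 0 := by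
    simp only [hh, mul_sub]
    rw [Finset.sum_sub_distrib, ← Finset.sum_mul, hp.2, ← hμ]; ring
  refine ⟨(∑ a, p a * h a ^ 2) / (γ - μ) ^ 2, fun n hn => ?_⟩
  have hn' : (0 : ℝ) < n := by exact_mod_cast hn
  have hd : 0 < γ - μ := sub_pos.2 hγ
  have key : ∀ ω : Fin n → α, (if (2 : ℝ) ^ ((n : ℝ) * γ) * ∏ i, g (ω i) < ∏ i, f (ω i)
        then ∏ i, p (ω i) else 0) ≤
      (n * (γ - μ))⁻¹ ^ 2 * ((∏ i, p (ω i)) * (∑ i, h (ω i)) ^ 2) := by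
    intro ω
    have hpn : 0 ≤ ∏ i, p (ω i) := Finset.prod_nonneg fun i _ => hp.1 _
    by_cases h0 : ∏ i, p (ω i) = 0
    · simp [h0]
    have hpos : ∀ i, 0 < p (ω i) := fun i =>
      lt_of_le_of_ne (hp.1 _) (fun h1 => h0 (Finset.prod_eq_zero (Finset.mem_univ i) h1.symm))
    split_ifs with hlt
    · have hgpos : 0 < ∏ i, g (ω i) := Finset.prod_pos fun i _ => hg _ (hpos i)
      have h1 : (2 : ℝ) ^ ((n : ℝ) * γ) < ∏ i, (f (ω i) / g (ω i)) := by
        rw [Finset.prod_div_distrib, lt_div_iff₀ hgpos]; exact hlt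
      have h2 : (n : ℝ) * γ < Real.logb 2 (∏ i, (f (ω i) / g (ω i))) :=
        (Real.lt_logb_iff_rpow_lt (by norm_num)
          (Finset.prod_pos fun i _ => div_pos (hf _ (hpos i)) (hg _ (hpos i)))).2 h1
      have h3 : Real.logb 2 (∏ i, (f (ω i) / g (ω i))) = ∑ i, Real.logb 2 (f (ω i) / g (ω i)) := by
        apply Real.logb_prod
        intro i _
        exact (div_pos (hf _ (hpos i)) (hg _ (hpos i))).ne'
      have h4 : (n : ℝ) * (γ - μ) ≤ ∑ i, h (ω i) := by
        simp only [hh, Finset.sum_sub_distrib, Finset.sum_const, Finset.card_univ,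
          Fintype.card_fin, nsmul_eq_mul]
        rw [h3] at h2
        linarith
      have h5 : 1 ≤ (n * (γ - μ))⁻¹ * ∑ i, h (ω i) := by
        rw [inv_mul_eq_div, le_div_iff₀ (mul_pos hn' hd)]; linarith
      have h6 : 1 ≤ ((n * (γ - μ))⁻¹ * ∑ i, h (ω i)) ^ 2 := one_le_pow₀ h5
      have := mul_le_mul_of_nonneg_left h6 hpn
      rw [mul_one] at this
      refine this.trans (le_of_eq ?_)
      ring
    · positivity
  refine (Finset.sum_le_sum fun ω _ => key ω).trans ?_
  rw [← Finset.mul_sum, sum_pi_prod_mul_sq_sum hp.2 hmean, Fintype.card_fin]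
  apply le_of_eq
  field_simp

/-! ### Causal kernels -/

/-- A causal sequence of kernels defines a pmf on sequences, and lower bounds on the conditional
expectations of the per-letter gains add up. -/
lemma causal_kernel_sum {T : Type} [Fintype T] [Nonempty T] : ∀ (n : ℕ)
    (κ : Fin n → (Fin n → T) → T → ℝ), (∀ i t, IsPMF (κ i t)) →
    (∀ i t t', (∀ m, m < i → t m = t' m) → κ i t = κ i t') →
    ∀ (g : Fin n → T → ℝ) (c : Fin n → ℝ), (∀ i t, c i ≤ ∑ s, κ i t s * g i s) →
    ∑ t : Fin n → T, ∏ i, κ i t (t i) = 1 ∧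
      ∑ i, c i ≤ ∑ t : Fin n → T, (∏ i, κ i t (t i)) * ∑ i, g i (t i) := by
  intro n
  induction n with
  | zero => intro κ _ _ g c _; simp
  | succ n ih =>
    intro κ hpmf hcaus g c hc
    obtain ⟨t₀⟩ : Nonempty (Fin (n + 1) → T) := inferInstance
    have h0 : ∀ t, κ 0 t = κ 0 t₀ := fun t => hcaus 0 t t₀ (fun m hm => absurd hm (by simp))
    have hrec := fun s : T => ih (fun i t => κ i.succ (Fin.cons s t)) (fun i t => hpmf _ _)
      (fun i t t' h => hcaus _ _ _ (fun m hm => by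
        refine Fin.cases ?_ (fun m hm => ?_) m hm
        · intro _; simp
        · simpa using h m (by simpa using hm)))
      (fun i => g i.succ) (fun i => c i.succ) (fun i t => hc _ _)
    have hsum : ∀ F : (Fin (n + 1) → T) → ℝ,
        ∑ t, F t = ∑ s, ∑ t : Fin n → T, F (Fin.cons s t) := by
      intro F
      rw [← (Fin.consEquiv (fun _ : Fin (n + 1) => T)).sum_comp, Fintype.sum_prod_type]
      rfl
    constructor
    · rw [hsum]
      simp_rw [Fin.prod_univ_succ, h0, Fin.cons_zero, Fin.cons_succ, ← Finset.mul_sum]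
      simp_rw [fun s => (hrec s).1, mul_one]
      exact (hpmf 0 t₀).2
    · rw [hsum]
      simp_rw [Fin.prod_univ_succ, Fin.sum_univ_succ, h0, Fin.cons_zero, Fin.cons_succ]
      calc c 0 + ∑ i : Fin n, c i.succ
          ≤ ∑ s, κ 0 t₀ s * g 0 s + ∑ i : Fin n, c i.succ := by gcongr; exact hc 0 t₀
        _ = ∑ s, κ 0 t₀ s * (g 0 s + ∑ i : Fin n, c i.succ) := by
            simp_rw [mul_add]
            rw [Finset.sum_add_distrib, ← Finset.sum_mul, (hpmf 0 t₀).2, one_mul]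
        _ ≤ _ := by
            apply Finset.sum_le_sum
            intro s _
            have := (hrec s).2
            simp_rw [mul_assoc, ← Finset.mul_sum, mul_add]
            rw [Finset.sum_add_distrib, ← Finset.sum_mul, (hrec s).1, one_mul, ← mul_add]
            gcongr
            exact (hpmf 0 t₀).1 s

lemma sum_arrow_prod {ι α β : Type} [Fintype ι] [DecidableEq ι] [Fintype α] [Fintype β]
    (F : (ι → α × β) → ℝ) :
    ∑ ω, F ω = ∑ a : ι → α, ∑ b : ι → β, F (fun i => (a i, b i)) := by
  rw [← (Equiv.arrowProdEquivProdArrow ι (fun _ => α) (fun _ => β)).symm.sum_comp,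
    Fintype.sum_prod_type]
  rfl

/-! ### Schemes from codebooks -/

/-- The memoryless extension of a channel with two inputs. -/
def likelihood {U V X : Type} {n : ℕ} (a : U → V → X → ℝ) (u : Fin n → U) (v : Fin n → V)
    (x : Fin n → X) : ℝ :=
  ∏ i, a (u i) (v i) (x i)

lemma isPMF_likelihood {U V X : Type} [Fintype X] {n : ℕ} {a : U → V → X → ℝ}
    (ha : ∀ u v, IsPMF (a u v)) (u : Fin n → U) (v : Fin n → V) : IsPMF (likelihood a u v) :=
  IsPMF.pi (fun i => ha (u i) (v i))

/-- A superposition codebook: each message carries a public codeword and a family of codewords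
indexed by the key. -/
abbrev Codebook (U V : Type) (R0 R : ℝ) (n : ℕ) : Type :=
  Fin (msgCard R n) → (Fin n → U) × (Fin (keyCard R0 n) → Fin n → V)

lemma msgCard_pos (R : ℝ) (n : ℕ) : 0 < msgCard R n := lt_of_lt_of_le one_pos (le_max_left _ _)

lemma keyCard_pos (R : ℝ) (n : ℕ) : 0 < keyCard R n := lt_of_lt_of_le one_pos (le_max_left _ _)

/-- The likelihood encoder of a codebook. -/
def likelihoodEnc {U V X : Type} {R0 R : ℝ} {n : ℕ} (a : U → V → X → ℝ) (c : Codebook U V R0 R n)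
    (x : Fin n → X) (k : Fin (keyCard R0 n)) (j : Fin (msgCard R n)) : ℝ :=
  if ∑ j', likelihood a (c j').1 ((c j').2 k) x = 0 then ((msgCard R n : ℝ))⁻¹
  else likelihood a (c j).1 ((c j).2 k) x / ∑ j', likelihood a (c j').1 ((c j').2 k) x

lemma isPMF_likelihoodEnc {U V X : Type} [Fintype X] {R0 R : ℝ} {n : ℕ} {a : U → V → X → ℝ}
    (ha : ∀ u v, IsPMF (a u v)) (c : Codebook U V R0 R n) (x : Fin n → X)
    (k : Fin (keyCard R0 n)) : IsPMF (likelihoodEnc a c x k) := by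
  have hJ : (0 : ℝ) < msgCard R n := by exact_mod_cast msgCard_pos R n
  unfold likelihoodEnc
  split_ifs with h
  · exact ⟨fun _ => by positivity, by simp [hJ.ne']⟩
  · refine ⟨fun j => div_nonneg ((isPMF_likelihood ha _ _).1 x)
      (Finset.sum_nonneg fun j _ => (isPMF_likelihood ha _ _).1 x), ?_⟩
    rw [← Finset.sum_div, div_self h]

lemma likelihoodEnc_mul_sum {U V X : Type} [Fintype X] {R0 R : ℝ} {n : ℕ} {a : U → V → X → ℝ}
    (ha : ∀ u v, IsPMF (a u v)) (c : Codebook U V R0 R n) (x : Fin n → X)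
    (k : Fin (keyCard R0 n)) (j : Fin (msgCard R n)) :
    likelihoodEnc a c x k j * ∑ j', likelihood a (c j').1 ((c j').2 k) x
      = likelihood a (c j).1 ((c j).2 k) x := by
  unfold likelihoodEnc
  split_ifs with h
  · rw [h, mul_zero]
    exact ((Finset.sum_eq_zero_iff_of_nonneg
      (fun j _ => (isPMF_likelihood ha _ _).1 x)).1 h j (Finset.mem_univ j)).symm
  · exact div_mul_cancel₀ _ h

/-- The scheme that encodes with the likelihood encoder and decodes by passing the codewords
selected by the message and the key through a memoryless channel. -/
def codebookScheme {X Y Z U V : Type} [Fintype X] [Fintype Y] [Fintype Z] {R0 R : ℝ} {n : ℕ}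
    {a : U → V → X → ℝ} {b : U → V → Y → ℝ} (ha : ∀ u v, IsPMF (a u v))
    (hb : ∀ u v, IsPMF (b u v)) (c : Codebook U V R0 R n) : Scheme X Y Z R0 R n where
  enc := likelihoodEnc a c
  enc_pmf := isPMF_likelihoodEnc ha c
  dec i j k _ _ _ := b ((c j).1 i) ((c j).2 k i)
  dec_pmf _ _ _ _ _ _ := hb _ _
  dec_causal _ _ _ _ _ _ _ _ _ _ _ _ := rfl

/-- The soft covering error of the source for a given key. -/
def sourceError {X U V : Type} [Fintype X] {R0 R : ℝ} {n : ℕ} (p0 : X → ℝ) (a : U → V → X → ℝ)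
    (c : Codebook U V R0 R n) (k : Fin (keyCard R0 n)) : ℝ :=
  ∑ x : Fin n → X, |(msgCard R n : ℝ)⁻¹ * ∑ j, likelihood a (c j).1 ((c j).2 k) x - ∏ i, p0 (x i)|

/-- The soft covering error of source and action given a public codeword. -/
def actionError {X Y U V : Type} [Fintype X] [Fintype Y] {K n : ℕ} (o : U → X → Y → ℝ)
    (a : U → V → X → ℝ) (b : U → V → Y → ℝ) (c : (Fin n → U) × (Fin K → Fin n → V)) : ℝ :=
  ∑ q : (Fin n → X) × (Fin n → Y),
    |(K : ℝ)⁻¹ * ∑ k, likelihood a c.1 (c.2 k) q.1 * likelihood b c.1 (c.2 k) q.2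
      - ∏ i, o (c.1 i) (q.1 i) (q.2 i)|

/-- The expected payoff given the message, source and actions. -/
def condPayoff {X Y Z : Type} [Fintype X] [Fintype Y] [Fintype Z] {R : ℝ} {n : ℕ}
    (π : X → Y → Z → ℝ) (A : Adversary X Y Z R n) (j : Fin (msgCard R n)) (x : Fin n → X)
    (y : Fin n → Y) : ℝ :=
  ∑ z : Fin n → Z, (∏ i, A.adv i j x y z (z i)) * ((n : ℝ)⁻¹ * ∑ i, π (x i) (y i) (z i))

lemma abs_condPayoff_le {X Y Z : Type} [Fintype X] [Fintype Y] [Fintype Z] [Nonempty Z] {R : ℝ}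
    {n : ℕ} (hn : 0 < n) {π : X → Y → Z → ℝ} {M : ℝ} (hM : ∀ x y z, |π x y z| ≤ M)
    (A : Adversary X Y Z R n) (j : Fin (msgCard R n)) (x : Fin n → X) (y : Fin n → Y) :
    |condPayoff π A j x y| ≤ M := by
  have hn' : (0 : ℝ) < n := by exact_mod_cast hn
  have h1 := (causal_kernel_sum n (fun i z => A.adv i j x y z) (fun i z => A.adv_pmf _ _ _ _ _)
    (fun i z z' h => A.adv_causal _ _ _ _ _ _ _ _ (fun _ _ => rfl) (fun _ _ => rfl) h)
    (fun _ _ => 0) (fun _ => 0) (by simp)).1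
  have hnn : ∀ z : Fin n → Z, 0 ≤ ∏ i, A.adv i j x y z (z i) := fun z =>
    Finset.prod_nonneg fun i _ => (A.adv_pmf _ _ _ _ _).1 _
  unfold condPayoff
  refine (Finset.abs_sum_le_sum_abs _ _).trans ?_
  calc ∑ z : Fin n → Z, |(∏ i, A.adv i j x y z (z i)) * ((n : ℝ)⁻¹ * ∑ i, π (x i) (y i) (z i))|
      ≤ ∑ z : Fin n → Z, (∏ i, A.adv i j x y z (z i)) * M := by
        apply Finset.sum_le_sum
        intro z _
        rw [abs_mul, abs_of_nonneg (hnn z)]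
        apply mul_le_mul_of_nonneg_left _ (hnn z)
        rw [abs_mul, abs_of_pos (inv_pos.2 hn'), inv_mul_le_iff₀ hn']
        refine (Finset.abs_sum_le_sum_abs _ _).trans ?_
        refine (Finset.sum_le_sum fun i _ => hM (x i) (y i) (z i)).trans ?_
        simp
    _ = M := by rw [← Finset.sum_mul, h1, one_mul]

/-- If source and action are memoryless given a public codeword, the adversary cannot do better
than responding to the public codeword letter by letter. -/
lemma le_sum_condPayoff {X Y Z U : Type} [Fintype X] [Fintype Y] [Fintype Z]
    [Nonempty X] [Nonempty Y] [Nonempty Z] {R : ℝ} {n : ℕ}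
    {π : X → Y → Z → ℝ} {o : U → X → Y → ℝ} (ho : ∀ u, IsPMF (fun q : X × Y => o u q.1 q.2))
    {m : U → ℝ} (hm : ∀ u z, m u ≤ ∑ x, ∑ y, o u x y * π x y z)
    (A : Adversary X Y Z R n) (j : Fin (msgCard R n)) (u : Fin n → U) :
    (n : ℝ)⁻¹ * ∑ i, m (u i) ≤
      ∑ x : Fin n → X, ∑ y : Fin n → Y, (∏ i, o (u i) (x i) (y i)) * condPayoff π A j x y := by
  have h := (causal_kernel_sum n
    (fun i (t : Fin n → X × Y × Z) s => o (u i) s.1 s.2.1 *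
      A.adv i j (fun i => (t i).1) (fun i => (t i).2.1) (fun i => (t i).2.2) s.2.2)
    (fun i t => by
      refine ⟨fun s => mul_nonneg ((ho (u i)).1 (s.1, s.2.1)) ((A.adv_pmf _ _ _ _ _).1 _), ?_⟩
      simp_rw [Fintype.sum_prod_type, ← Finset.mul_sum, (A.adv_pmf _ _ _ _ _).2, mul_one]
      have := (ho (u i)).2
      rwa [Fintype.sum_prod_type] at this)
    (fun i t t' h => by
      have := A.adv_causal i j (fun i => (t i).1) (fun i => (t i).2.1) (fun i => (t i).2.2)
        (fun i => (t' i).1) (fun i => (t' i).2.1) (fun i => (t' i).2.2)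
        (fun m hm => by rw [h m hm]) (fun m hm => by rw [h m hm]) (fun m hm => by rw [h m hm])
      rw [this])
    (fun _ s => π s.1 s.2.1 s.2.2) (fun i => m (u i))
    (fun i t => by
      have hpm := A.adv_pmf i j (fun i => (t i).1) (fun i => (t i).2.1) (fun i => (t i).2.2)
      set p := A.adv i j (fun i => (t i).1) (fun i => (t i).2.1) (fun i => (t i).2.2) with hp
      calc m (u i) = ∑ z, p z * m (u i) := by rw [← Finset.sum_mul, hpm.2, one_mul]
        _ ≤ ∑ z, p z * ∑ x, ∑ y, o (u i) x y * π x y z :=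
          Finset.sum_le_sum fun z _ => mul_le_mul_of_nonneg_left (hm _ _) (hpm.1 z)
        _ = _ := by
          simp_rw [Fintype.sum_prod_type, Finset.mul_sum]
          rw [Finset.sum_comm]
          refine Finset.sum_congr rfl fun x _ => ?_
          rw [Finset.sum_comm]
          refine Finset.sum_congr rfl fun y _ => Finset.sum_congr rfl fun z _ => ?_
          ring)).2
  have h2 := mul_le_mul_of_nonneg_left h (inv_nonneg.2 (Nat.cast_nonneg (α := ℝ) n))
  refine h2.trans (le_of_eq ?_)
  rw [sum_arrow_prod, Finset.mul_sum]
  refine Finset.sum_congr rfl fun x _ => ?_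
  rw [sum_arrow_prod, Finset.mul_sum]
  refine Finset.sum_congr rfl fun y _ => ?_
  unfold condPayoff
  rw [Finset.mul_sum, Finset.mul_sum]
  refine Finset.sum_congr rfl fun z _ => ?_
  rw [Finset.prod_mul_distrib]
  ring

lemma avgValue_codebookScheme {X Y Z U V : Type} [Fintype X] [Fintype Y] [Fintype Z] {R0 R : ℝ}
    {n : ℕ} {a : U → V → X → ℝ} {b : U → V → Y → ℝ} (ha : ∀ u v, IsPMF (a u v))
    (hb : ∀ u v, IsPMF (b u v)) (p0 : X → ℝ) (π : X → Y → Z → ℝ) (c : Codebook U V R0 R n)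
    (A : Adversary X Y Z R n) :
    avgValue p0 π (codebookScheme ha hb c) A = ∑ j, ∑ x : Fin n → X, ∑ y : Fin n → Y,
      (∑ k, (∏ i, p0 (x i)) * ((keyCard R0 n : ℝ))⁻¹ * likelihoodEnc a c x k j *
        likelihood b (c j).1 ((c j).2 k) y) * condPayoff π A j x y := by
  have h : avgValue p0 π (codebookScheme ha hb c) A
      = ∑ x : Fin n → X, ∑ k, ∑ j, ∑ y : Fin n → Y,
        ((∏ i, p0 (x i)) * ((keyCard R0 n : ℝ))⁻¹ * likelihoodEnc a c x k j *
        likelihood b (c j).1 ((c j).2 k) y) * condPayoff π A j x y := by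
    unfold avgValue jointPMF condPayoff
    simp_rw [Fintype.sum_prod_type, Finset.mul_sum, Finset.prod_mul_distrib]
    refine Finset.sum_congr rfl fun x _ => Finset.sum_congr rfl fun k _ =>
      Finset.sum_congr rfl fun j _ => Finset.sum_congr rfl fun y _ =>
      Finset.sum_congr rfl fun z _ => Finset.sum_congr rfl fun i _ => ?_
    simp only [codebookScheme, likelihood]
    ring
  rw [h, Finset.sum_congr rfl fun x _ => Finset.sum_comm, Finset.sum_comm]
  refine Finset.sum_congr rfl fun j _ => Finset.sum_congr rfl fun x _ => ?_
  rw [Finset.sum_comm]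
  exact Finset.sum_congr rfl fun y _ => (Finset.sum_mul _ _ _).symm

/-- The value of a codebook scheme against any adversary, in terms of its soft covering errors. -/
lemma le_avgValue_codebookScheme {X Y Z U V : Type} [Fintype X] [Fintype Y] [Fintype Z]
    [Nonempty X] [Nonempty Y] [Nonempty Z] {R0 R : ℝ} {n : ℕ} (hn : 0 < n)
    {a : U → V → X → ℝ} {b : U → V → Y → ℝ} (ha : ∀ u v, IsPMF (a u v))
    (hb : ∀ u v, IsPMF (b u v)) (p0 : X → ℝ) {π : X → Y → Z → ℝ} {M : ℝ}
    (hM : ∀ x y z, |π x y z| ≤ M) {o : U → X → Y → ℝ}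
    (ho : ∀ u, IsPMF (fun q : X × Y => o u q.1 q.2)) {m : U → ℝ}
    (hm : ∀ u z, m u ≤ ∑ x, ∑ y, o u x y * π x y z) (c : Codebook U V R0 R n)
    (A : Adversary X Y Z R n) :
    (msgCard R n : ℝ)⁻¹ * ∑ j, (n : ℝ)⁻¹ * ∑ i, m ((c j).1 i)
      - M * ((keyCard R0 n : ℝ)⁻¹ * ∑ k, sourceError p0 a c k
        + (msgCard R n : ℝ)⁻¹ * ∑ j, actionError o a b (c j))
      ≤ avgValue p0 π (codebookScheme ha hb c) A := by
  have hJ : (0 : ℝ) < msgCard R n := by exact_mod_cast msgCard_pos R n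
  have hK : (0 : ℝ) < keyCard R0 n := by exact_mod_cast keyCard_pos R0 n
  rw [avgValue_codebookScheme]
  set J : ℝ := (msgCard R n : ℝ) with hJdef
  set K : ℝ := (keyCard R0 n : ℝ) with hKdef
  set F := condPayoff π A with hF
  set P : Fin (msgCard R n) → (Fin n → X) → (Fin n → Y) → ℝ := fun j x y =>
    ∑ k, (∏ i, p0 (x i)) * K⁻¹ * likelihoodEnc a c x k j * likelihood b (c j).1 ((c j).2 k) y
    with hP
  set D : (Fin n → X) → Fin (keyCard R0 n) → ℝ := fun x k =>
    |J⁻¹ * ∑ j, likelihood a (c j).1 ((c j).2 k) x - ∏ i, p0 (x i)| with hD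
  have hdiff : ∀ j x y, |P j x y - J⁻¹ * ∏ i, o ((c j).1 i) (x i) (y i)| ≤
      K⁻¹ * ∑ k, likelihoodEnc a c x k j * likelihood b (c j).1 ((c j).2 k) y * D x k
      + J⁻¹ * |K⁻¹ * ∑ k, likelihood a (c j).1 ((c j).2 k) x * likelihood b (c j).1 ((c j).2 k) y
        - ∏ i, o ((c j).1 i) (x i) (y i)| := by
    intro j x y
    have hsplit : P j x y - J⁻¹ * ∏ i, o ((c j).1 i) (x i) (y i) =
        (∑ k, -(K⁻¹ * (likelihoodEnc a c x k j * likelihood b (c j).1 ((c j).2 k) y *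
          (J⁻¹ * ∑ j, likelihood a (c j).1 ((c j).2 k) x - ∏ i, p0 (x i)))))
        + J⁻¹ * (K⁻¹ * ∑ k, likelihood a (c j).1 ((c j).2 k) x *
          likelihood b (c j).1 ((c j).2 k) y - ∏ i, o ((c j).1 i) (x i) (y i)) := by
      have hk : ∀ k, -(K⁻¹ * (likelihoodEnc a c x k j * likelihood b (c j).1 ((c j).2 k) y *
          (J⁻¹ * ∑ j, likelihood a (c j).1 ((c j).2 k) x - ∏ i, p0 (x i))))
          = (∏ i, p0 (x i)) * K⁻¹ * likelihoodEnc a c x k j *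
              likelihood b (c j).1 ((c j).2 k) y
            - J⁻¹ * K⁻¹ * (likelihood a (c j).1 ((c j).2 k) x *
              likelihood b (c j).1 ((c j).2 k) y) := by
        intro k
        rw [← likelihoodEnc_mul_sum ha c x k j]
        ring
      simp_rw [hk]
      rw [Finset.sum_sub_distrib, ← Finset.mul_sum]
      simp only [hP]
      ring
    rw [hsplit]
    refine (abs_add_le _ _).trans (add_le_add ?_ ?_)
    · refine (Finset.abs_sum_le_sum_abs _ _).trans (le_of_eq ?_)
      rw [Finset.mul_sum]
      refine Finset.sum_congr rfl fun k _ => ?_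
      rw [abs_neg, abs_mul, abs_mul, abs_mul, abs_of_pos (inv_pos.2 hK),
        abs_of_nonneg ((isPMF_likelihoodEnc ha c x k).1 j),
        abs_of_nonneg ((isPMF_likelihood hb _ _).1 y)]
    · rw [abs_mul, abs_of_pos (inv_pos.2 hJ)]
  have htotal : ∑ j, ∑ x : Fin n → X, ∑ y : Fin n → Y,
      |P j x y - J⁻¹ * ∏ i, o ((c j).1 i) (x i) (y i)| ≤
      K⁻¹ * ∑ k, sourceError p0 a c k + J⁻¹ * ∑ j, actionError o a b (c j) := by
    refine (Finset.sum_le_sum fun j _ => Finset.sum_le_sum fun x _ =>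
      Finset.sum_le_sum fun y _ => hdiff j x y).trans (le_of_eq ?_)
    simp_rw [Finset.sum_add_distrib, ← Finset.mul_sum]
    congr 2
    · rw [Finset.sum_comm]
      have h1 : ∀ x : Fin n → X, ∑ j, ∑ y : Fin n → Y, ∑ k, likelihoodEnc a c x k j *
          likelihood b (c j).1 ((c j).2 k) y * D x k = ∑ k, D x k := by
        intro x
        have h2 : ∀ j, ∑ y : Fin n → Y, ∑ k, likelihoodEnc a c x k j *
            likelihood b (c j).1 ((c j).2 k) y * D x k
            = ∑ k, likelihoodEnc a c x k j * D x k := by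
          intro j
          rw [Finset.sum_comm]
          refine Finset.sum_congr rfl fun k _ => ?_
          rw [← Finset.sum_mul, ← Finset.mul_sum, (isPMF_likelihood hb _ _).2, mul_one]
        simp_rw [h2]
        rw [Finset.sum_comm]
        refine Finset.sum_congr rfl fun k _ => ?_
        rw [← Finset.sum_mul, (isPMF_likelihoodEnc ha c x k).2, one_mul]
      simp_rw [h1]
      rw [Finset.sum_comm]
      rfl
    · refine Finset.sum_congr rfl fun j _ => ?_
      unfold actionError
      rw [Fintype.sum_prod_type]
  have hideal : J⁻¹ * ∑ j, (n : ℝ)⁻¹ * ∑ i, m ((c j).1 i) ≤ ∑ j, ∑ x : Fin n → X,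
      ∑ y : Fin n → Y, J⁻¹ * (∏ i, o ((c j).1 i) (x i) (y i)) * F j x y := by
    have h := mul_le_mul_of_nonneg_left
      (Finset.sum_le_sum fun j (_ : j ∈ Finset.univ) => le_sum_condPayoff ho hm A j (c j).1)
      (inv_nonneg.2 hJ.le)
    refine h.trans (le_of_eq ?_)
    simp_rw [mul_assoc, ← Finset.mul_sum]
    rfl
  have hM0 : 0 ≤ M := by
    obtain ⟨x⟩ := ‹Nonempty X›
    obtain ⟨y⟩ := ‹Nonempty Y›
    obtain ⟨z⟩ := ‹Nonempty Z›
    exact (abs_nonneg _).trans (hM x y z)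
  have hcompare : ∑ j, ∑ x : Fin n → X, ∑ y : Fin n → Y,
        J⁻¹ * (∏ i, o ((c j).1 i) (x i) (y i)) * F j x y
      - M * ∑ j, ∑ x : Fin n → X, ∑ y : Fin n → Y,
        |P j x y - J⁻¹ * ∏ i, o ((c j).1 i) (x i) (y i)|
      ≤ ∑ j, ∑ x : Fin n → X, ∑ y : Fin n → Y, P j x y * F j x y := by
    simp_rw [Finset.mul_sum, ← Finset.sum_sub_distrib]
    refine Finset.sum_le_sum fun j _ => Finset.sum_le_sum fun x _ =>
      Finset.sum_le_sum fun y _ => ?_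
    set d := P j x y - J⁻¹ * ∏ i, o ((c j).1 i) (x i) (y i) with hd
    have h1 : |d * F j x y| ≤ M * |d| := by
      rw [abs_mul, mul_comm]
      exact mul_le_mul_of_nonneg_right (abs_condPayoff_le hn hM A j x y) (abs_nonneg _)
    have h2 := (abs_le.1 h1).1
    have h3 : P j x y = d + J⁻¹ * ∏ i, o ((c j).1 i) (x i) (y i) := by rw [hd]; ring
    rw [h3, add_mul]
    linarith
  have := mul_le_mul_of_nonneg_left htotal hM0
  linarith

/-! ### Random superposition codebooks -/

/-- Auxiliary variables `U`, `V` together with memoryless channels to the source and the action: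
the joint pmf is `r(u) s(v|u) a(x|u,v) b(y|u,v)`. -/
structure AuxChannel (X Y U V : Type) [Fintype X] [Fintype Y] [Fintype U] [Fintype V] where
  r : U → ℝ
  s : U → V → ℝ
  a : U → V → X → ℝ
  b : U → V → Y → ℝ
  isPMF_r : IsPMF r
  isPMF_s : ∀ u, IsPMF (s u)
  isPMF_a : ∀ u v, IsPMF (a u v)
  isPMF_b : ∀ u v, IsPMF (b u v)

namespace AuxChannel

variable {X Y U V : Type} [Fintype X] [Fintype Y] [Fintype U] [Fintype V]

/-- The pmf of the source letter. -/
def source (c : AuxChannel X Y U V) (x : X) : ℝ := ∑ u, ∑ v, c.r u * c.s u v * c.a u v x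

/-- The conditional pmf of source and action letters given `U`. -/
def out (c : AuxChannel X Y U V) (u : U) (x : X) (y : Y) : ℝ :=
  ∑ v, c.s u v * (c.a u v x * c.b u v y)

/-- The mutual information `I(X;U,V)` as an expected information density. -/
def sourceInfo (c : AuxChannel X Y U V) : ℝ :=
  ∑ q : U × V × X, c.r q.1 * c.s q.1 q.2.1 * c.a q.1 q.2.1 q.2.2 *
    Real.logb 2 (c.a q.1 q.2.1 q.2.2 / c.source q.2.2)

/-- The conditional mutual information `I(X,Y;V|U)` as an expected information density. -/
def actionInfo (c : AuxChannel X Y U V) : ℝ :=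
  ∑ q : U × V × X × Y,
    c.r q.1 * c.s q.1 q.2.1 * (c.a q.1 q.2.1 q.2.2.1 * c.b q.1 q.2.1 q.2.2.2) *
    Real.logb 2 (c.a q.1 q.2.1 q.2.2.1 * c.b q.1 q.2.1 q.2.2.2 / c.out q.1 q.2.2.1 q.2.2.2)

lemma isPMF_out (c : AuxChannel X Y U V) (u : U) :
    IsPMF (fun q : X × Y => c.out u q.1 q.2) := by
  refine ⟨fun q => Finset.sum_nonneg fun v _ => mul_nonneg ((c.isPMF_s u).1 v)
    (mul_nonneg ((c.isPMF_a u v).1 _) ((c.isPMF_b u v).1 _)), ?_⟩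
  unfold out
  rw [Finset.sum_comm]
  simp_rw [Fintype.sum_prod_type, ← Finset.mul_sum, (c.isPMF_b _ _).2, mul_one,
    (c.isPMF_a _ _).2, mul_one]
  exact (c.isPMF_s u).2

/-- The pmf of a public codeword with its family of key-dependent codewords. -/
def clusterProb (c : AuxChannel X Y U V) {K n : ℕ} (w : (Fin n → U) × (Fin K → Fin n → V)) : ℝ :=
  (∏ i, c.r (w.1 i)) * ∏ k, ∏ i, c.s (w.1 i) (w.2 k i)

lemma isPMF_prod_s (c : AuxChannel X Y U V) {n : ℕ} (u : Fin n → U) :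
    IsPMF (fun v : Fin n → V => ∏ i, c.s (u i) (v i)) :=
  IsPMF.pi fun i => c.isPMF_s (u i)

lemma sum_clusterProb_mul (c : AuxChannel X Y U V) {K n : ℕ}
    (F : (Fin n → U) × (Fin K → Fin n → V) → ℝ) :
    ∑ w, c.clusterProb w * F w = ∑ u : Fin n → U, (∏ i, c.r (u i)) *
      ∑ v : Fin K → Fin n → V, (∏ k, ∏ i, c.s (u i) (v k i)) * F (u, v) := by
  unfold clusterProb
  rw [Fintype.sum_prod_type]
  simp_rw [Finset.mul_sum, mul_assoc]

lemma isPMF_clusterProb (c : AuxChannel X Y U V) {K n : ℕ} :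
    IsPMF (c.clusterProb (K := K) (n := n)) := by
  refine ⟨fun w => mul_nonneg (Finset.prod_nonneg fun i _ => c.isPMF_r.1 _)
    (Finset.prod_nonneg fun k _ => (c.isPMF_prod_s w.1).1 _), ?_⟩
  have h := c.sum_clusterProb_mul (K := K) (n := n) (fun _ => 1)
  simp_rw [mul_one] at h
  rw [h]
  simp_rw [(IsPMF.pi fun _ : Fin K => c.isPMF_prod_s _).2, mul_one]
  exact (IsPMF.pi fun _ : Fin n => c.isPMF_r).2

lemma sum_clusterProb_mul_public (c : AuxChannel X Y U V) {K n : ℕ} (i : Fin n) (F : U → ℝ) :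
    ∑ w : (Fin n → U) × (Fin K → Fin n → V), c.clusterProb w * F (w.1 i) = ∑ u, c.r u * F u := by
  rw [c.sum_clusterProb_mul (fun w => F (w.1 i))]
  simp_rw [← Finset.sum_mul, (IsPMF.pi fun _ : Fin K => c.isPMF_prod_s _).2, one_mul]
  exact sum_pi_prod_mul_eval (p := fun _ : Fin n => c.r) (fun _ => c.isPMF_r.2) i F

lemma sum_clusterProb_mul_key (c : AuxChannel X Y U V) {K n : ℕ} (k : Fin K)
    (F : (Fin n → U) → (Fin n → V) → ℝ) :
    ∑ w, c.clusterProb w * F w.1 (w.2 k) =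
      ∑ u : Fin n → U, ∑ v : Fin n → V, (∏ i, c.r (u i) * c.s (u i) (v i)) * F u v := by
  rw [c.sum_clusterProb_mul (fun w => F w.1 (w.2 k))]
  refine Finset.sum_congr rfl fun u _ => ?_
  rw [sum_pi_prod_mul_eval (p := fun _ v => ∏ i, c.s (u i) (v i))
    (fun _ => (c.isPMF_prod_s u).2) k (F u), Finset.mul_sum]
  refine Finset.sum_congr rfl fun v _ => ?_
  rw [Finset.prod_mul_distrib, mul_assoc]

end AuxChannel

/-! ### Asymptotics of the soft covering errors -/

lemma rpow_le_two_mul_msgCard (R : ℝ) (n : ℕ) : (2 : ℝ) ^ ((n : ℝ) * R) ≤ 2 * msgCard R n := by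
  have h1 := Nat.lt_floor_add_one ((2 : ℝ) ^ ((n : ℝ) * R))
  have h2 : (⌊(2 : ℝ) ^ ((n : ℝ) * R)⌋₊ : ℝ) ≤ msgCard R n := by
    exact_mod_cast le_max_right _ _
  have h3 : (1 : ℝ) ≤ msgCard R n := by exact_mod_cast le_max_left _ _
  linarith

open Filter Topology in
lemma tendsto_soft_covering_bound {γ R : ℝ} (h : γ < R) (c : ℝ) :
    Tendsto (fun n : ℕ => 2 * (c / n) + √((msgCard R n : ℝ)⁻¹ * (2 : ℝ) ^ ((n : ℝ) * γ)))
      atTop (𝓝 0) := by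
  have h1 : Tendsto (fun n : ℕ => 2 * (c / (n : ℝ))) atTop (𝓝 0) := by
    simpa using (tendsto_const_div_atTop_nhds_zero_nat c).const_mul 2
  have h2 : Tendsto (fun n : ℕ => (msgCard R n : ℝ)⁻¹ * (2 : ℝ) ^ ((n : ℝ) * γ)) atTop (𝓝 0) := by
    have hq : Tendsto (fun n : ℕ => 2 * ((2 : ℝ) ^ (γ - R)) ^ n) atTop (𝓝 0) := by
      simpa using (tendsto_pow_atTop_nhds_zero_of_lt_one (Real.rpow_nonneg (by norm_num) _)
        (Real.rpow_lt_one_of_one_lt_of_neg (by norm_num) (sub_neg.2 h))).const_mul (2 : ℝ)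
    refine squeeze_zero (fun n => by positivity) (fun n => ?_) hq
    have hpos : (0 : ℝ) < msgCard R n := by exact_mod_cast msgCard_pos R n
    rw [inv_mul_le_iff₀ hpos, ← Real.rpow_natCast, ← Real.rpow_mul (by norm_num)]
    have e : (2 : ℝ) ^ ((n : ℝ) * γ)
        = (2 : ℝ) ^ ((n : ℝ) * R) * (2 : ℝ) ^ ((γ - R) * (n : ℝ)) := by
      rw [← Real.rpow_add (by norm_num)]; congr 1; ring
    rw [e]
    have := mul_le_mul_of_nonneg_right (rpow_le_two_mul_msgCard R n)
      (Real.rpow_nonneg (by norm_num : (0 : ℝ) ≤ 2) ((γ - R) * (n : ℝ)))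
    linarith
  have h3 := h2.sqrt
  simpa using h1.add h3

namespace AuxChannel

variable {X Y U V : Type} [Fintype X] [Fintype Y] [Fintype U] [Fintype V]

lemma prod_source (c : AuxChannel X Y U V) {n : ℕ} (x : Fin n → X) :
    ∏ i, c.source (x i) = ∑ u : Fin n → U, ∑ v : Fin n → V,
      (∏ i, c.r (u i) * c.s (u i) (v i)) * likelihood c.a u v x := by
  unfold source likelihood
  simp_rw [← Fintype.sum_prod_type', ← Finset.prod_mul_distrib]
  rw [Fintype.sum_prod_type,
    ← sum_arrow_prod (fun ω : Fin n → U × V => ∏ i, c.r (ω i).1 * c.s (ω i).1 (ω i).2 *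
      c.a (ω i).1 (ω i).2 (x i)),
    sum_pi_prod (fun i (q : U × V) => c.r q.1 * c.s q.1 q.2 * c.a q.1 q.2 (x i))]

lemma source_pos (c : AuxChannel X Y U V) {u : U} {v : V} {x : X}
    (h : 0 < c.r u * c.s u v * c.a u v x) : 0 < c.source x := by
  refine h.trans_le ?_
  have hn : ∀ u v, 0 ≤ c.r u * c.s u v * c.a u v x := fun u v =>
    mul_nonneg (mul_nonneg (c.isPMF_r.1 u) ((c.isPMF_s u).1 v)) ((c.isPMF_a u v).1 x)
  exact (Finset.single_le_sum (f := fun v => c.r u * c.s u v * c.a u v x)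
      (fun v _ => hn u v) (Finset.mem_univ v)).trans
    (Finset.single_le_sum (f := fun u => ∑ v, c.r u * c.s u v * c.a u v x)
      (fun u _ => Finset.sum_nonneg fun v _ => hn u v) (Finset.mem_univ u))

lemma out_pos (c : AuxChannel X Y U V) {u : U} {v : V} {x : X} {y : Y}
    (h : 0 < c.s u v * (c.a u v x * c.b u v y)) : 0 < c.out u x y :=
  h.trans_le (Finset.single_le_sum (f := fun v => c.s u v * (c.a u v x * c.b u v y))
    (fun v _ => mul_nonneg ((c.isPMF_s u).1 v)
      (mul_nonneg ((c.isPMF_a u v).1 _) ((c.isPMF_b u v).1 _))) (Finset.mem_univ v))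

lemma isPMF_source_joint (c : AuxChannel X Y U V) :
    IsPMF (fun q : U × V × X => c.r q.1 * c.s q.1 q.2.1 * c.a q.1 q.2.1 q.2.2) := by
  refine ⟨fun q => mul_nonneg (mul_nonneg (c.isPMF_r.1 _) ((c.isPMF_s _).1 _))
    ((c.isPMF_a _ _).1 _), ?_⟩
  simp_rw [Fintype.sum_prod_type, ← Finset.mul_sum, (c.isPMF_a _ _).2, mul_one,
    ← Finset.mul_sum, (c.isPMF_s _).2, mul_one]
  exact c.isPMF_r.2

lemma isPMF_action_joint (c : AuxChannel X Y U V) :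
    IsPMF (fun q : U × V × X × Y =>
      c.r q.1 * c.s q.1 q.2.1 * (c.a q.1 q.2.1 q.2.2.1 * c.b q.1 q.2.1 q.2.2.2)) := by
  refine ⟨fun q => mul_nonneg (mul_nonneg (c.isPMF_r.1 _) ((c.isPMF_s _).1 _))
    (mul_nonneg ((c.isPMF_a _ _).1 _) ((c.isPMF_b _ _).1 _)), ?_⟩
  simp_rw [Fintype.sum_prod_type, ← Finset.mul_sum, (c.isPMF_b _ _).2, mul_one,
    (c.isPMF_a _ _).2, mul_one, ← Finset.mul_sum, (c.isPMF_s _).2, mul_one]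
  exact c.isPMF_r.2

open Filter Topology in
/-- The expected soft covering error of the source vanishes above the mutual information, or at
any rate if the source is independent of the auxiliary variables. -/
lemma exists_tendsto_sourceError (c : AuxChannel X Y U V) {R : ℝ}
    (h : c.sourceInfo < R ∨ ∀ u v, 0 < c.r u → 0 < c.s u v → ∀ x, c.a u v x = c.source x)
    (R0 : ℝ) :
    ∃ e : ℕ → ℝ, Tendsto e atTop (𝓝 0) ∧ ∀ n, 0 < n → ∀ k,
      ∑ w : Codebook U V R0 R n, (∏ j, c.clusterProb (w j)) * sourceError c.source c.a w k
        ≤ e n := by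
  rcases h with h | h
  · obtain ⟨γ, hγ, hγR⟩ := exists_between h
    obtain ⟨C, hC⟩ := sum_pi_prod_ite_lt_le c.isPMF_source_joint
      (f := fun q => c.a q.1 q.2.1 q.2.2) (g := fun q => c.source q.2.2)
      (fun q hq => pos_of_mul_pos_right hq
        (mul_nonneg (c.isPMF_r.1 _) ((c.isPMF_s _).1 _)))
      (fun q hq => c.source_pos hq) hγ
    refine ⟨_, tendsto_soft_covering_bound hγR C, fun n hn k => ?_⟩
    have : Nonempty (Fin (msgCard R n)) := ⟨⟨0, msgCard_pos R n⟩⟩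
    have hsc := soft_covering (ι := Fin (msgCard R n))
      (c.isPMF_clusterProb (K := keyCard R0 n) (n := n))
      (W := fun w x => likelihood c.a w.1 (w.2 k) x)
      (fun w => isPMF_likelihood c.isPMF_a _ _) (o := fun x => ∏ i, c.source (x i))
      (fun x => by
        rw [c.sum_clusterProb_mul_key k (fun u v => likelihood c.a u v x), c.prod_source])
      (T := (2 : ℝ) ^ ((n : ℝ) * γ)) (by positivity)
    rw [Fintype.card_fin] at hsc
    refine hsc.trans ?_
    gcongr
    refine le_trans (le_of_eq ?_) (hC n hn)
    rw [c.sum_clusterProb_mul_key k (fun u v => ∑ x : Fin n → X,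
      if (2 : ℝ) ^ ((n : ℝ) * γ) * ∏ i, c.source (x i) < likelihood c.a u v x
        then likelihood c.a u v x else 0), sum_arrow_prod]
    refine Finset.sum_congr rfl fun u _ => ?_
    rw [sum_arrow_prod]
    refine Finset.sum_congr rfl fun v _ => ?_
    rw [Finset.mul_sum]
    refine Finset.sum_congr rfl fun x _ => ?_
    unfold likelihood
    rw [mul_ite, mul_zero, ← Finset.prod_mul_distrib]
  · refine ⟨fun _ => 0, tendsto_const_nhds, fun n hn k => ?_⟩
    have : Nonempty (Fin (msgCard R n)) := ⟨⟨0, msgCard_pos R n⟩⟩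
    have hsc := soft_covering_of_forall_eq (ι := Fin (msgCard R n))
      (c.isPMF_clusterProb (K := keyCard R0 n) (n := n))
      (W := fun w x => likelihood c.a w.1 (w.2 k) x) (o := fun x => ∏ i, c.source (x i))
      (fun w hw x => Finset.prod_congr rfl fun i _ => by
        have h1 : (∏ i, c.r (w.1 i)) ≠ 0 := left_ne_zero_of_mul hw.ne'
        have h2 : (∏ k, ∏ i, c.s (w.1 i) (w.2 k i)) ≠ 0 := right_ne_zero_of_mul hw.ne'
        have h3 := Finset.prod_ne_zero_iff.1 h2 k (Finset.mem_univ _)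
        exact h _ _
          ((c.isPMF_r.1 _).lt_of_ne' (Finset.prod_ne_zero_iff.1 h1 i (Finset.mem_univ _)))
          (((c.isPMF_s _).1 _).lt_of_ne' (Finset.prod_ne_zero_iff.1 h3 i (Finset.mem_univ _))) _)
    rw [Fintype.card_fin] at hsc
    exact hsc.le

open Filter Topology in
/-- The expected soft covering error of source and action given the public codeword vanishes above
the conditional mutual information, or at any rate under conditional independence. -/
lemma exists_tendsto_actionError (c : AuxChannel X Y U V) {R0 : ℝ}
    (h : c.actionInfo < R0 ∨ ∀ u v, 0 < c.r u → 0 < c.s u v → ∀ x y,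
      c.a u v x * c.b u v y = c.out u x y) :
    ∃ e : ℕ → ℝ, Tendsto e atTop (𝓝 0) ∧ ∀ n, 0 < n →
      ∑ w : (Fin n → U) × (Fin (keyCard R0 n) → Fin n → V),
        c.clusterProb w * actionError c.out c.a c.b w ≤ e n := by
  rcases h with h | h
  · obtain ⟨γ, hγ, hγR⟩ := exists_between h
    obtain ⟨C, hC⟩ := sum_pi_prod_ite_lt_le c.isPMF_action_joint
      (f := fun q => c.a q.1 q.2.1 q.2.2.1 * c.b q.1 q.2.1 q.2.2.2)
      (g := fun q => c.out q.1 q.2.2.1 q.2.2.2)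
      (fun q hq => pos_of_mul_pos_right hq
        (mul_nonneg (c.isPMF_r.1 _) ((c.isPMF_s _).1 _)))
      (fun ⟨u, v, x, y⟩ hq => c.out_pos (u := u) (v := v) (x := x) (y := y)
        (pos_of_mul_pos_right (by simpa only [mul_assoc] using hq) (c.isPMF_r.1 u))) hγ
    refine ⟨_, tendsto_soft_covering_bound hγR C, fun n hn => ?_⟩
    have : Nonempty (Fin (keyCard R0 n)) := ⟨⟨0, keyCard_pos R0 n⟩⟩
    have hpr : ∀ u : Fin n → U, 0 ≤ ∏ i, c.r (u i) := fun u =>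
      Finset.prod_nonneg fun i _ => c.isPMF_r.1 _
    have hsc := fun u : Fin n → U => soft_covering (ι := Fin (keyCard R0 n))
      (c.isPMF_prod_s u)
      (W := fun v (q : (Fin n → X) × (Fin n → Y)) =>
        likelihood c.a u v q.1 * likelihood c.b u v q.2)
      (fun v => ⟨fun q => mul_nonneg ((isPMF_likelihood c.isPMF_a _ _).1 _)
          ((isPMF_likelihood c.isPMF_b _ _).1 _), by
        simp_rw [Fintype.sum_prod_type, ← Finset.mul_sum, (isPMF_likelihood c.isPMF_b _ _).2,
          mul_one, (isPMF_likelihood c.isPMF_a _ _).2]⟩)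
      (o := fun q => ∏ i, c.out (u i) (q.1 i) (q.2 i))
      (fun q => by
        unfold out likelihood
        rw [← sum_pi_prod (fun i v => c.s (u i) v * (c.a (u i) v (q.1 i) * c.b (u i) v (q.2 i)))]
        simp_rw [Finset.prod_mul_distrib])
      (T := (2 : ℝ) ^ ((n : ℝ) * γ)) (by positivity)
    rw [Fintype.card_fin] at hsc
    rw [c.sum_clusterProb_mul]
    refine (Finset.sum_le_sum fun u _ => mul_le_mul_of_nonneg_left (hsc u) (hpr u)).trans ?_
    simp_rw [mul_add]
    rw [Finset.sum_add_distrib, ← Finset.sum_mul, (IsPMF.pi fun _ : Fin n => c.isPMF_r).2, one_mul]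
    refine add_le_add ?_ le_rfl
    simp_rw [mul_left_comm _ (2 : ℝ)]
    rw [← Finset.mul_sum]
    gcongr
    refine le_trans (le_of_eq ?_) (hC n hn)
    rw [sum_arrow_prod]
    refine Finset.sum_congr rfl fun u _ => ?_
    rw [sum_arrow_prod, Finset.mul_sum]
    refine Finset.sum_congr rfl fun v _ => ?_
    rw [sum_arrow_prod, Fintype.sum_prod_type, Finset.mul_sum, Finset.mul_sum]
    refine Finset.sum_congr rfl fun x _ => ?_
    rw [Finset.mul_sum, Finset.mul_sum]
    refine Finset.sum_congr rfl fun y _ => ?_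
    unfold likelihood
    simp_rw [mul_ite, mul_zero, Finset.prod_mul_distrib, mul_assoc]
  · refine ⟨fun _ => 0, tendsto_const_nhds, fun n hn => ?_⟩
    have : Nonempty (Fin (keyCard R0 n)) := ⟨⟨0, keyCard_pos R0 n⟩⟩
    rw [c.sum_clusterProb_mul]
    refine (Finset.sum_eq_zero fun u _ => ?_).le
    by_cases hu : ∏ i, c.r (u i) = 0
    · rw [hu, zero_mul]
    have hsc := soft_covering_of_forall_eq (ι := Fin (keyCard R0 n))
      (c.isPMF_prod_s u)
      (W := fun v (q : (Fin n → X) × (Fin n → Y)) =>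
        likelihood c.a u v q.1 * likelihood c.b u v q.2)
      (o := fun q => ∏ i, c.out (u i) (q.1 i) (q.2 i))
      (fun v hv q => by
        unfold likelihood
        rw [← Finset.prod_mul_distrib]
        refine Finset.prod_congr rfl fun i _ => h _ _ ?_ ?_ _ _
        · exact (c.isPMF_r.1 _).lt_of_ne' (Finset.prod_ne_zero_iff.1 hu i (Finset.mem_univ _))
        · exact ((c.isPMF_s _).1 _).lt_of_ne'
            (Finset.prod_ne_zero_iff.1 hv.ne' i (Finset.mem_univ _)))
    rw [Fintype.card_fin] at hsc
    exact mul_eq_zero_of_right _ hsc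

open Filter Topology in
/-- Achievability for an auxiliary channel whose information quantities are below the rates, or
vanish identically. -/
theorem exists_scheme (c : AuxChannel X Y U V) {Z : Type} [Fintype Z]
    [Nonempty X] [Nonempty Y] [Nonempty Z] (π : X → Y → Z → ℝ) {R0 R : ℝ}
    (hR : c.sourceInfo < R ∨ ∀ u v, 0 < c.r u → 0 < c.s u v → ∀ x, c.a u v x = c.source x)
    (hR0 : c.actionInfo < R0 ∨ ∀ u v, 0 < c.r u → 0 < c.s u v → ∀ x y,
      c.a u v x * c.b u v y = c.out u x y)
    {m : U → ℝ} (hm : ∀ u z, m u ≤ ∑ x, ∑ y, c.out u x y * π x y z) {ε : ℝ} (hε : 0 < ε) :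
    ∃ (n : ℕ) (_ : 0 < n) (S : Scheme X Y Z R0 R n), ∀ A : Adversary X Y Z R n,
      ∑ u, c.r u * m u - ε ≤ avgValue c.source π S A := by
  obtain ⟨M, hM⟩ : ∃ M, ∀ x y z, |π x y z| ≤ M := by
    obtain ⟨M, hM⟩ := (Set.finite_range fun q : X × Y × Z => |π q.1 q.2.1 q.2.2|).bddAbove
    exact ⟨M, fun x y z => hM ⟨(x, y, z), rfl⟩⟩
  have hM0 : 0 ≤ M := by
    obtain ⟨x⟩ := ‹Nonempty X›
    obtain ⟨y⟩ := ‹Nonempty Y›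
    obtain ⟨z⟩ := ‹Nonempty Z›
    exact (abs_nonneg _).trans (hM x y z)
  obtain ⟨e₁, he₁, hs⟩ := c.exists_tendsto_sourceError hR R0
  obtain ⟨e₂, he₂, ha⟩ := c.exists_tendsto_actionError hR0
  have hlim : Tendsto (fun n => M * (e₁ n + e₂ n)) atTop (𝓝 0) := by
    simpa using (he₁.add he₂).const_mul M
  obtain ⟨n, hn, hnε⟩ := ((eventually_gt_atTop 0).and (hlim.eventually (gt_mem_nhds hε))).exists
  have hn' : (0 : ℝ) < n := by exact_mod_cast hn
  have hJ : (0 : ℝ) < msgCard R n := by exact_mod_cast msgCard_pos R n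
  have hK : (0 : ℝ) < keyCard R0 n := by exact_mod_cast keyCard_pos R0 n
  have hcl : ∀ _ : Fin (msgCard R n), IsPMF (c.clusterProb (K := keyCard R0 n) (n := n)) :=
    fun _ => c.isPMF_clusterProb
  have hmarg : ∀ (F : (Fin n → U) × (Fin (keyCard R0 n) → Fin n → V) → ℝ) j,
      ∑ w : Codebook U V R0 R n, (∏ j, c.clusterProb (w j)) * F (w j)
        = ∑ q, c.clusterProb q * F q := fun F j =>
    sum_pi_prod_mul_eval (fun j => (hcl j).2) j F
  obtain ⟨w, hw⟩ := (IsPMF.pi hcl).exists_le_of_le_sum (v := ∑ u, c.r u * m u - ε)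
    (G := fun w : Codebook U V R0 R n =>
      (msgCard R n : ℝ)⁻¹ * ∑ j, (n : ℝ)⁻¹ * ∑ i, m ((w j).1 i)
      - M * ((keyCard R0 n : ℝ)⁻¹ * ∑ k, sourceError c.source c.a w k
        + (msgCard R n : ℝ)⁻¹ * ∑ j, actionError c.out c.a c.b (w j))) (by
      have hlin : ∀ w : Codebook U V R0 R n, (∏ j, c.clusterProb (w j)) *
          ((msgCard R n : ℝ)⁻¹ * ∑ j, (n : ℝ)⁻¹ * ∑ i, m ((w j).1 i)
          - M * ((keyCard R0 n : ℝ)⁻¹ * ∑ k, sourceError c.source c.a w k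
          + (msgCard R n : ℝ)⁻¹ * ∑ j, actionError c.out c.a c.b (w j)))
          = (msgCard R n : ℝ)⁻¹ * ∑ j, (n : ℝ)⁻¹ *
              ∑ i, (∏ j, c.clusterProb (w j)) * m ((w j).1 i)
          - M * ((keyCard R0 n : ℝ)⁻¹ * ∑ k,
              (∏ j, c.clusterProb (w j)) * sourceError c.source c.a w k
          + (msgCard R n : ℝ)⁻¹ * ∑ j,
              (∏ j, c.clusterProb (w j)) * actionError c.out c.a c.b (w j)) := by
        intro w
        simp_rw [← Finset.mul_sum]
        ring
      simp_rw [hlin]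
      rw [Finset.sum_sub_distrib, ← Finset.mul_sum, ← Finset.mul_sum, Finset.sum_add_distrib,
        ← Finset.mul_sum, ← Finset.mul_sum, Finset.sum_comm]
      rw [Finset.sum_comm (s := Finset.univ) (t := (Finset.univ : Finset (Fin (keyCard R0 n))))]
      rw [Finset.sum_comm (s := (Finset.univ : Finset (Codebook U V R0 R n)))
        (t := (Finset.univ : Finset (Fin (msgCard R n))))]
      have h1 : ∀ j : Fin (msgCard R n), ∑ w : Codebook U V R0 R n, (n : ℝ)⁻¹ *
          ∑ i, (∏ j, c.clusterProb (w j)) * m ((w j).1 i) = ∑ u, c.r u * m u := by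
        intro j
        rw [← Finset.mul_sum, Finset.sum_comm]
        have : ∀ i : Fin n, ∑ w : Codebook U V R0 R n, (∏ j, c.clusterProb (w j)) * m ((w j).1 i)
            = ∑ u, c.r u * m u := fun i => by
          rw [hmarg (fun q => m (q.1 i)) j, c.sum_clusterProb_mul_public i m]
        simp_rw [this]
        simp [hn'.ne']
      have h2 : (keyCard R0 n : ℝ)⁻¹ * ∑ k, ∑ w : Codebook U V R0 R n,
          (∏ j, c.clusterProb (w j)) * sourceError c.source c.a w k ≤ e₁ n := by
        rw [inv_mul_le_iff₀ hK]
        refine (Finset.sum_le_sum fun k _ => hs n hn k).trans (le_of_eq ?_)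
        simp
      have h3 : (msgCard R n : ℝ)⁻¹ * ∑ j, ∑ w : Codebook U V R0 R n,
          (∏ j, c.clusterProb (w j)) * actionError c.out c.a c.b (w j) ≤ e₂ n := by
        rw [inv_mul_le_iff₀ hJ]
        refine (Finset.sum_le_sum fun j _ => (hmarg _ j).trans_le (ha n hn)).trans (le_of_eq ?_)
        simp
      have h4 : (msgCard R n : ℝ)⁻¹ * ∑ j : Fin (msgCard R n), ∑ u, c.r u * m u
          = ∑ u, c.r u * m u := by
        rw [Finset.sum_const, Finset.card_univ, Fintype.card_fin, nsmul_eq_mul,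
          inv_mul_cancel_left₀ hJ.ne']
      simp_rw [h1]
      rw [h4]
      have := mul_le_mul_of_nonneg_left (add_le_add h2 h3) hM0
      linarith)
  exact ⟨n, hn, codebookScheme c.isPMF_a c.isPMF_b w, fun A => hw.trans
    (le_avgValue_codebookScheme hn c.isPMF_a c.isPMF_b c.source hM c.isPMF_out hm w A)⟩

end AuxChannel

/-! ### Vanishing information and time sharing -/

/-- A weighted divergence that is nonpositive forces equality wherever the weight is positive. -/
lemma eq_of_sum_mul_logb_le_zero {α : Type} [Fintype α] {ρ f g : α → ℝ} (hρ : ∀ a, 0 ≤ ρ a)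
    (hf : ∀ a, 0 ≤ f a) (hg : ∀ a, 0 ≤ g a) (hac : ∀ a, 0 < ρ a * f a → 0 < g a)
    (hsum : ∑ a, ρ a * g a ≤ ∑ a, ρ a * f a)
    (hD : ∑ a, ρ a * f a * Real.logb 2 (f a / g a) ≤ 0) (a : α) (ha : 0 < ρ a) : f a = g a := by
  have hterm : ∀ a, ρ a * f a * Real.logb 2 (f a / g a) * Real.log 2
      = ρ a * g a * InformationTheory.klFun (f a / g a) - ρ a * g a + ρ a * f a := by
    intro a
    have hlog : Real.logb 2 (f a / g a) * Real.log 2 = Real.log (f a / g a) := by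
      rw [Real.logb, div_mul_cancel₀ _ (Real.log_pos one_lt_two).ne']
    rw [mul_assoc, hlog, InformationTheory.klFun_apply]
    by_cases hga : g a = 0
    · have : ρ a * f a = 0 := by
        by_contra h
        exact (hac a ((mul_nonneg (hρ a) (hf a)).lt_of_ne' h)).ne' hga
      simp [this, hga]
    · field_simp
      ring
  have hle : ∑ a, ρ a * g a * InformationTheory.klFun (f a / g a) ≤ 0 := by
    have h1 := mul_nonpos_of_nonpos_of_nonneg hD (Real.log_pos one_lt_two).le
    rw [Finset.sum_mul] at h1
    simp_rw [hterm] at h1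
    rw [Finset.sum_add_distrib, Finset.sum_sub_distrib] at h1
    linarith
  have hnn : ∀ a ∈ Finset.univ, 0 ≤ ρ a * g a * InformationTheory.klFun (f a / g a) :=
    fun a _ => mul_nonneg (mul_nonneg (hρ a) (hg a))
      (InformationTheory.klFun_nonneg (div_nonneg (hf a) (hg a)))
  have hz := (Finset.sum_eq_zero_iff_of_nonneg hnn).1
    (le_antisymm hle (Finset.sum_nonneg hnn)) a (Finset.mem_univ a)
  rcases (hg a).eq_or_lt with hga | hga
  · rw [← hga]
    by_contra h
    exact (hac a (mul_pos ha ((hf a).lt_of_ne' h))).ne hga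
  · have := (mul_eq_zero.1 hz).resolve_left (mul_pos ha hga).ne'
    rw [InformationTheory.klFun_eq_zero_iff (div_nonneg (hf a) hga.le)] at this
    exact (div_eq_one_iff_eq hga.ne').1 this

namespace AuxChannel

variable {X Y U V : Type} [Fintype X] [Fintype Y] [Fintype U] [Fintype V]

lemma isPMF_source (c : AuxChannel X Y U V) : IsPMF c.source := by
  refine ⟨fun x => Finset.sum_nonneg fun u _ => Finset.sum_nonneg fun v _ =>
    mul_nonneg (mul_nonneg (c.isPMF_r.1 u) ((c.isPMF_s u).1 v)) ((c.isPMF_a u v).1 x), ?_⟩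
  rw [← c.isPMF_source_joint.2]
  unfold source
  rw [Finset.sum_comm, Fintype.sum_prod_type]
  refine Finset.sum_congr rfl fun u _ => ?_
  rw [Finset.sum_comm, Fintype.sum_prod_type]

lemma eq_source_of_sourceInfo_le_zero (c : AuxChannel X Y U V) (h : c.sourceInfo ≤ 0) (u : U)
    (v : V) (hu : 0 < c.r u) (hv : 0 < c.s u v) (x : X) : c.a u v x = c.source x := by
  refine eq_of_sum_mul_logb_le_zero (ρ := fun q : U × V × X => c.r q.1 * c.s q.1 q.2.1)
    (f := fun q => c.a q.1 q.2.1 q.2.2) (g := fun q => c.source q.2.2)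
    (fun q => mul_nonneg (c.isPMF_r.1 _) ((c.isPMF_s _).1 _)) (fun q => (c.isPMF_a _ _).1 _)
    (fun q => c.isPMF_source.1 _) (fun q hq => c.source_pos hq) ?_ h (u, v, x) (mul_pos hu hv)
  rw [c.isPMF_source_joint.2]
  simp_rw [Fintype.sum_prod_type, ← Finset.mul_sum, c.isPMF_source.2, mul_one, ← Finset.mul_sum,
    (c.isPMF_s _).2, mul_one]
  exact c.isPMF_r.2.le

lemma eq_out_of_actionInfo_le_zero (c : AuxChannel X Y U V) (h : c.actionInfo ≤ 0) (u : U)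
    (v : V) (hu : 0 < c.r u) (hv : 0 < c.s u v) (x : X) (y : Y) :
    c.a u v x * c.b u v y = c.out u x y := by
  refine eq_of_sum_mul_logb_le_zero (ρ := fun q : U × V × X × Y => c.r q.1 * c.s q.1 q.2.1)
    (f := fun q => c.a q.1 q.2.1 q.2.2.1 * c.b q.1 q.2.1 q.2.2.2)
    (g := fun q => c.out q.1 q.2.2.1 q.2.2.2)
    (fun q => mul_nonneg (c.isPMF_r.1 _) ((c.isPMF_s _).1 _))
    (fun q => mul_nonneg ((c.isPMF_a _ _).1 _) ((c.isPMF_b _ _).1 _))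
    (fun q => (c.isPMF_out q.1).1 q.2.2)
    (fun ⟨u, v, x, y⟩ hq => c.out_pos (u := u) (v := v) (x := x) (y := y)
        (pos_of_mul_pos_right (by simpa only [mul_assoc] using hq) (c.isPMF_r.1 u)))
    ?_ h (u, v, x, y) (mul_pos hu hv)
  rw [c.isPMF_action_joint.2]
  have ho : ∀ u, ∑ x, ∑ y, c.out u x y = 1 := fun u => by
    rw [← (c.isPMF_out u).2, Fintype.sum_prod_type]
  simp_rw [Fintype.sum_prod_type, ← Finset.mul_sum, ho, mul_one, ← Finset.mul_sum,
    (c.isPMF_s _).2, mul_one]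
  exact c.isPMF_r.2.le

/-- With probability `δ`, replace the auxiliary variables by a public symbol that carries no
information about source and action. -/
def timeShare (c : AuxChannel X Y U V) (u₀ : U) (v₀ : V) (δ : ℝ) (h0 : 0 ≤ δ) (h1 : δ ≤ 1) :
    AuxChannel X Y (Option U) V where
  r u := u.elim δ fun u => (1 - δ) * c.r u
  s u := u.elim (c.s u₀) c.s
  a u v := u.elim c.source fun u => c.a u v
  b u v := u.elim (c.b u₀ v₀) fun u => c.b u v
  isPMF_r := ⟨fun u => by
      cases u
      · exact h0
      · exact mul_nonneg (sub_nonneg.2 h1) (c.isPMF_r.1 _), by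
      rw [Fintype.sum_option]
      simp [← Finset.mul_sum, c.isPMF_r.2]⟩
  isPMF_s u := by
    cases u
    · exact c.isPMF_s _
    · exact c.isPMF_s _
  isPMF_a u v := by
    cases u
    · exact c.isPMF_source
    · exact c.isPMF_a _ _
  isPMF_b u v := by
    cases u
    · exact c.isPMF_b _ _
    · exact c.isPMF_b _ _

variable (c : AuxChannel X Y U V) (u₀ : U) (v₀ : V) {δ : ℝ} (h0 : 0 ≤ δ) (h1 : δ ≤ 1)

lemma timeShare_source : (c.timeShare u₀ v₀ δ h0 h1).source = c.source := by
  funext x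
  unfold source timeShare
  rw [Fintype.sum_option]
  simp only [Option.elim]
  simp_rw [mul_assoc, ← Finset.mul_sum, ← Finset.sum_mul]
  rw [(c.isPMF_s u₀).2]
  simp only [source]
  simp_rw [mul_assoc, ← Finset.mul_sum]
  ring

lemma timeShare_out_some (u : U) (x : X) (y : Y) :
    (c.timeShare u₀ v₀ δ h0 h1).out (some u) x y = c.out u x y := rfl

lemma timeShare_out_none (x : X) (y : Y) :
    (c.timeShare u₀ v₀ δ h0 h1).out none x y = c.source x * c.b u₀ v₀ y := by
  simp only [out, timeShare, Option.elim]
  rw [← Finset.sum_mul, (c.isPMF_s u₀).2, one_mul]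

lemma logb_div_self_eq_zero (t : ℝ) : Real.logb 2 (t / t) = 0 := by
  by_cases h : t = 0 <;> simp [h]

lemma timeShare_sourceInfo :
    (c.timeShare u₀ v₀ δ h0 h1).sourceInfo = (1 - δ) * c.sourceInfo := by
  unfold sourceInfo
  rw [timeShare_source, Fintype.sum_prod_type, Fintype.sum_option, Fintype.sum_prod_type]
  simp only [timeShare, Option.elim, logb_div_self_eq_zero, mul_zero, Finset.sum_const_zero,
    zero_add, mul_assoc, Finset.mul_sum]
  simp_rw [Fintype.sum_prod_type]

lemma timeShare_actionInfo :
    (c.timeShare u₀ v₀ δ h0 h1).actionInfo = (1 - δ) * c.actionInfo := by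
  unfold actionInfo
  rw [Fintype.sum_prod_type, Fintype.sum_option, Fintype.sum_prod_type]
  simp_rw [timeShare_out_some, timeShare_out_none]
  simp only [timeShare, Option.elim, logb_div_self_eq_zero, mul_zero, Finset.sum_const_zero,
    zero_add, mul_assoc, Finset.mul_sum]
  simp_rw [Fintype.sum_prod_type]

open Filter Topology in
/-- Achievability for an auxiliary channel whose information quantities do not exceed the rates. -/
theorem exists_scheme_of_le (c : AuxChannel X Y U V) {Z : Type} [Fintype Z]
    [Nonempty X] [Nonempty Y] [Nonempty Z] [Nonempty U] [Nonempty V] (π : X → Y → Z → ℝ)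
    {R0 R : ℝ} (hR0 : 0 ≤ R0) (hR : 0 ≤ R) (hI : c.sourceInfo ≤ R) (hI0 : c.actionInfo ≤ R0)
    {m : U → ℝ} (hm : ∀ u z, m u ≤ ∑ x, ∑ y, c.out u x y * π x y z) {ε : ℝ} (hε : 0 < ε) :
    ∃ (n : ℕ) (_ : 0 < n) (S : Scheme X Y Z R0 R n), ∀ A : Adversary X Y Z R n,
      ∑ u, c.r u * m u - ε ≤ avgValue c.source π S A := by
  obtain ⟨u₀⟩ := ‹Nonempty U›
  obtain ⟨v₀⟩ := ‹Nonempty V›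
  obtain ⟨M, hM⟩ : ∃ M, ∀ z, M ≤ ∑ x, ∑ y, c.source x * c.b u₀ v₀ y * π x y z := by
    obtain ⟨M, hM⟩ := (Set.finite_range fun z =>
      ∑ x, ∑ y, c.source x * c.b u₀ v₀ y * π x y z).bddBelow
    exact ⟨M, fun z => hM ⟨z, rfl⟩⟩
  set v := ∑ u, c.r u * m u with hv
  obtain ⟨δ, hδ0, hδ1, hδ⟩ : ∃ δ : ℝ, 0 < δ ∧ δ < 1 ∧ v - ε / 2 < δ * M + (1 - δ) * v := by
    have hcont : Tendsto (fun δ : ℝ => δ * M + (1 - δ) * v) (𝓝[>] 0) (𝓝 v) := by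
      have : Continuous fun δ : ℝ => δ * M + (1 - δ) * v := by fun_prop
      simpa using (this.tendsto 0).mono_left nhdsWithin_le_nhds
    have hlt : v - ε / 2 < v := by linarith
    obtain ⟨δ, h1, h2⟩ := ((hcont.eventually (lt_mem_nhds hlt)).and
      (Ioo_mem_nhdsGT (zero_lt_one (α := ℝ)))).exists
    exact ⟨δ, h2.1, h2.2, h1⟩
  have hslack : ∀ {I S : ℝ}, 0 < S → I ≤ S → (1 - δ) * I < S := fun hS hIS => by nlinarith
  set c' := c.timeShare u₀ v₀ δ hδ0.le hδ1.le with hc'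
  have hRc : c'.sourceInfo < R ∨
      ∀ u v, 0 < c'.r u → 0 < c'.s u v → ∀ x, c'.a u v x = c'.source x := by
    rcases hR.eq_or_lt with h | h
    · right
      apply c'.eq_source_of_sourceInfo_le_zero
      rw [hc', timeShare_sourceInfo]
      exact mul_nonpos_of_nonneg_of_nonpos (by linarith) (h ▸ hI)
    · left
      rw [hc', timeShare_sourceInfo]
      exact hslack h hI
  have hR0c : c'.actionInfo < R0 ∨ ∀ u v, 0 < c'.r u → 0 < c'.s u v → ∀ x y,
      c'.a u v x * c'.b u v y = c'.out u x y := by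
    rcases hR0.eq_or_lt with h | h
    · right
      apply c'.eq_out_of_actionInfo_le_zero
      rw [hc', timeShare_actionInfo]
      exact mul_nonpos_of_nonneg_of_nonpos (by linarith) (h ▸ hI0)
    · left
      rw [hc', timeShare_actionInfo]
      exact hslack h hI0
  obtain ⟨n, hn, S, hS⟩ := c'.exists_scheme π hRc hR0c (m := fun u => u.elim M m)
    (by
      rintro (_ | u) z
      · simp_rw [hc', timeShare_out_none]
        exact hM z
      · exact hm u z) (half_pos hε)
  refine ⟨n, hn, S, fun A => ?_⟩
  have hval : ∑ u, c'.r u * (u.elim M m) = δ * M + (1 - δ) * v := by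
    rw [Fintype.sum_option]
    simp only [hc', timeShare, Option.elim, mul_assoc, hv, Finset.mul_sum]
  have := hS A
  rw [hval, hc', timeShare_source] at this
  linarith

end AuxChannel

/-! ### Single-letter distributions as auxiliary channels -/

lemma probOf_nonneg {Ω α : Type} [Fintype Ω] {p : Ω → ℝ} (hp : ∀ ω, 0 ≤ p ω) (A : Ω → α) (a : α) :
    0 ≤ probOf p A a :=
  Finset.sum_nonneg fun ω _ => by split_ifs <;> simp [hp]

lemma sum_probOf_prodMk {Ω α β : Type} [Fintype Ω] [Fintype β] (p : Ω → ℝ) (A : Ω → α) (B : Ω → β)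
    (a : α) : ∑ b, probOf p (fun ω => (A ω, B ω)) (a, b) = probOf p A a := by
  unfold probOf
  rw [Finset.sum_comm]
  refine Finset.sum_congr rfl fun ω _ => ?_
  by_cases h : A ω = a <;> simp [Prod.ext_iff, h]

lemma sum_probOf {Ω α : Type} [Fintype Ω] [Fintype α] (p : Ω → ℝ) (A : Ω → α) :
    ∑ a, probOf p A a = ∑ ω, p ω := by
  unfold probOf
  rw [Finset.sum_comm]
  simp

lemma probOf_comp {Ω α β : Type} [Fintype Ω] (p : Ω → ℝ) (A : Ω → α) {f : α → β}
    (hf : Function.Injective f) (a : α) : probOf p (fun ω => f (A ω)) (f a) = probOf p A a := by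
  unfold probOf
  simp [hf.eq_iff]

lemma probOf_id {Ω : Type} [Fintype Ω] (p : Ω → ℝ) (a : Ω) : probOf p (fun ω => ω) a = p a := by
  simp [probOf]

lemma entropy_eq_neg_sum {Ω α : Type} [Fintype Ω] [Fintype α] (p : Ω → ℝ) (A : Ω → α) :
    entropy p A = -∑ ω, p ω * Real.logb 2 (probOf p A (A ω)) := by
  unfold entropy
  have h : ∀ a, probOf p A a * Real.logb 2 (probOf p A a)
      = ∑ ω, if A ω = a then p ω * Real.logb 2 (probOf p A a) else 0 := by
    intro a
    generalize Real.logb 2 (probOf p A a) = L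
    unfold probOf
    rw [Finset.sum_mul]
    simp_rw [ite_mul, zero_mul]
  simp_rw [h]
  rw [Finset.sum_comm]
  simp

/-- The conditional pmf obtained by normalizing, uniform where the total mass vanishes. -/
def condPMF {α β : Type} [Fintype β] (p : α → β → ℝ) (a : α) (b : β) : ℝ :=
  if ∑ b', p a b' = 0 then (Fintype.card β : ℝ)⁻¹ else p a b / ∑ b', p a b'

lemma isPMF_condPMF {α β : Type} [Fintype β] [Nonempty β] {p : α → β → ℝ}
    (hp : ∀ a b, 0 ≤ p a b) (a : α) : IsPMF (condPMF p a) := by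
  unfold condPMF
  split_ifs with h
  · exact ⟨fun _ => by positivity, by simp⟩
  · exact ⟨fun b => div_nonneg (hp a b) (Finset.sum_nonneg fun b _ => hp a b), by
      rw [← Finset.sum_div, div_self h]⟩

lemma sum_mul_condPMF {α β : Type} [Fintype β] {p : α → β → ℝ}
    (hp : ∀ a b, 0 ≤ p a b) (a : α) (b : β) : (∑ b', p a b') * condPMF p a b = p a b := by
  unfold condPMF
  split_ifs with h
  · rw [h, zero_mul]
    exact ((Finset.sum_eq_zero_iff_of_nonneg fun b _ => hp a b).1 h b (Finset.mem_univ b)).symm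
  · exact mul_div_cancel₀ _ h

/-- The auxiliary channel of a joint pmf of `(X, Y, U, V)`. -/
def auxChannelOf {X Y U V : Type} [Fintype X] [Fintype Y] [Fintype U] [Fintype V] [Nonempty X]
    [Nonempty Y] [Nonempty V] {p : X × Y × U × V → ℝ} (hp : IsPMF p) : AuxChannel X Y U V where
  r := probOf p fun q => q.2.2.1
  s := condPMF fun u v => probOf p (fun q => q.2.2) (u, v)
  a u v := condPMF (fun (w : U × V) x => probOf p (fun q => (q.2.2, q.1)) (w, x)) (u, v)
  b u v := condPMF (fun (w : U × V) y => probOf p (fun q => (q.2.2, q.2.1)) (w, y)) (u, v)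
  isPMF_r := ⟨probOf_nonneg hp.1 _, by rw [sum_probOf, hp.2]⟩
  isPMF_s := isPMF_condPMF fun _ _ => probOf_nonneg hp.1 _ _
  isPMF_a _ _ := isPMF_condPMF (fun _ _ => probOf_nonneg hp.1 _ _) _
  isPMF_b _ _ := isPMF_condPMF (fun _ _ => probOf_nonneg hp.1 _ _) _

section auxChannelOf

variable {X Y U V : Type} [Fintype X] [Fintype Y] [Fintype U] [Fintype V] [Nonempty X]
    [Nonempty Y] [Nonempty V] {p : X × Y × U × V → ℝ} (hp : IsPMF p)

lemma auxChannelOf_r_mul_s (u : U) (v : V) :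
    (auxChannelOf hp).r u * (auxChannelOf hp).s u v = probOf p (fun q => q.2.2) (u, v) := by
  have h := sum_mul_condPMF (p := fun u v => probOf p (fun q => q.2.2) (u, v))
    (fun _ _ => probOf_nonneg hp.1 _ _) u v
  rw [← h]
  congr 1
  exact (sum_probOf_prodMk p (fun q => q.2.2.1) (fun q => q.2.2.2) u).symm

lemma auxChannelOf_r_mul_s_mul_a (u : U) (v : V) (x : X) :
    (auxChannelOf hp).r u * (auxChannelOf hp).s u v * (auxChannelOf hp).a u v x
      = probOf p (fun q => (q.1, q.2.2)) (x, u, v) := by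
  have h := sum_mul_condPMF
    (p := fun (w : U × V) x => probOf p (fun q => (q.2.2, q.1)) (w, x))
    (fun _ _ => probOf_nonneg hp.1 _ _) (u, v) x
  rw [auxChannelOf_r_mul_s, ← sum_probOf_prodMk p (fun q => q.2.2) (fun q => q.1)]
  refine h.trans ?_
  exact probOf_comp p (fun q => (q.1, q.2.2)) (f := Prod.swap) Prod.swap_injective (x, u, v)

lemma auxChannelOf_r_mul_s_mul_b (u : U) (v : V) (y : Y) :
    (auxChannelOf hp).r u * (auxChannelOf hp).s u v * (auxChannelOf hp).b u v y
      = probOf p (fun q => (q.2.1, q.2.2)) (y, u, v) := by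
  have h := sum_mul_condPMF
    (p := fun (w : U × V) y => probOf p (fun q => (q.2.2, q.2.1)) (w, y))
    (fun _ _ => probOf_nonneg hp.1 _ _) (u, v) y
  rw [auxChannelOf_r_mul_s, ← sum_probOf_prodMk p (fun q => q.2.2) (fun q => q.2.1)]
  refine h.trans ?_
  exact probOf_comp p (fun q => (q.2.1, q.2.2)) (f := Prod.swap) Prod.swap_injective (y, u, v)

lemma auxChannelOf_source (x : X) :
    (auxChannelOf hp).source x = probOf p (fun q => q.1) x := by
  unfold AuxChannel.source
  simp_rw [auxChannelOf_r_mul_s_mul_a]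
  rw [← sum_probOf_prodMk p (fun q => q.1) (fun q => q.2.2), Fintype.sum_prod_type]

lemma auxChannelOf_joint
    (hci : CondIndep p (fun q => q.1) (fun q => q.2.1) (fun q => q.2.2))
    (u : U) (v : V) (x : X) (y : Y) :
    (auxChannelOf hp).r u * (auxChannelOf hp).s u v *
      ((auxChannelOf hp).a u v x * (auxChannelOf hp).b u v y) = p (x, y, u, v) := by
  have h := hci x y (u, v)
  rw [probOf_id p (x, y, u, v), ← auxChannelOf_r_mul_s hp, ← auxChannelOf_r_mul_s_mul_a hp,
    ← auxChannelOf_r_mul_s_mul_b hp] at h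
  set t := (auxChannelOf hp).r u * (auxChannelOf hp).s u v with ht
  by_cases h0 : t = 0
  · rw [h0, zero_mul]
    rw [ht, auxChannelOf_r_mul_s] at h0
    unfold probOf at h0
    have := (Finset.sum_eq_zero_iff_of_nonneg (fun ω _ => by
      split_ifs
      · exact hp.1 ω
      · exact le_rfl)).1 h0 (x, y, u, v) (Finset.mem_univ _)
    simpa using this.symm
  · apply mul_right_cancel₀ h0
    rw [h]
    ring

lemma auxChannelOf_r_mul_out
    (hci : CondIndep p (fun q => q.1) (fun q => q.2.1) (fun q => q.2.2))
    (u : U) (x : X) (y : Y) :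
    (auxChannelOf hp).r u * (auxChannelOf hp).out u x y
      = probOf p (fun q => ((q.1, q.2.1), q.2.2.1)) ((x, y), u) := by
  unfold AuxChannel.out
  rw [Finset.mul_sum]
  simp_rw [← mul_assoc ((auxChannelOf hp).r u), auxChannelOf_joint hp hci]
  rw [← sum_probOf_prodMk p (fun q => ((q.1, q.2.1), q.2.2.1)) (fun q => q.2.2.2)]
  refine Finset.sum_congr rfl fun v _ => ?_
  rw [← probOf_id p (x, y, u, v)]
  exact (probOf_comp p (fun q => q) (f := fun q => (((q.1, q.2.1), q.2.2.1), q.2.2.2))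
    (fun q q' h => by simp only [Prod.mk.injEq] at h; ext <;> tauto) (x, y, u, v)).symm

lemma sum_mul_eq_sum_auxChannelOf
    (hci : CondIndep p (fun q => q.1) (fun q => q.2.1) (fun q => q.2.2))
    (F : U → V → X → Y → ℝ) :
    ∑ q, p q * F q.2.2.1 q.2.2.2 q.1 q.2.1 = ∑ u, ∑ v, ∑ x, ∑ y,
      (auxChannelOf hp).r u * (auxChannelOf hp).s u v *
        ((auxChannelOf hp).a u v x * (auxChannelOf hp).b u v y) * F u v x y := by
  simp_rw [auxChannelOf_joint hp hci, Fintype.sum_prod_type]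
  rw [Finset.sum_congr rfl fun x _ => Finset.sum_comm, Finset.sum_comm]
  refine Finset.sum_congr rfl fun u _ => ?_
  rw [Finset.sum_congr rfl fun x _ => Finset.sum_comm, Finset.sum_comm]

lemma auxChannelOf_sourceInfo
    (hci : CondIndep p (fun q => q.1) (fun q => q.2.1) (fun q => q.2.2)) :
    (auxChannelOf hp).sourceInfo = mutualInfo p (fun q => q.1) (fun q => q.2.2) := by
  have h1 : mutualInfo p (fun q => q.1) (fun q => q.2.2) = ∑ q, p q *
      Real.logb 2 ((auxChannelOf hp).a q.2.2.1 q.2.2.2 q.1 / (auxChannelOf hp).source q.1) := by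
    unfold mutualInfo
    rw [entropy_eq_neg_sum, entropy_eq_neg_sum, entropy_eq_neg_sum, ← Finset.sum_neg_distrib,
      ← Finset.sum_neg_distrib, ← Finset.sum_neg_distrib, ← Finset.sum_add_distrib,
      ← Finset.sum_sub_distrib]
    refine Finset.sum_congr rfl fun q _ => ?_
    obtain ⟨x, y, u, v⟩ := q
    dsimp only
    by_cases h0 : p (x, y, u, v) = 0
    · simp [h0]
    rw [← auxChannelOf_source hp, ← auxChannelOf_r_mul_s hp, ← auxChannelOf_r_mul_s_mul_a hp]
    rw [← auxChannelOf_joint hp hci] at h0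
    set c := auxChannelOf hp
    have hrs : c.r u * c.s u v ≠ 0 := left_ne_zero_of_mul h0
    have ha : c.a u v x ≠ 0 := left_ne_zero_of_mul (right_ne_zero_of_mul h0)
    have hs : c.source x ≠ 0 := by
      refine (c.source_pos (u := u) (v := v) ?_).ne'
      exact (mul_nonneg (mul_nonneg (c.isPMF_r.1 u) ((c.isPMF_s u).1 v))
        ((c.isPMF_a u v).1 x)).lt_of_ne' (mul_ne_zero hrs ha)
    rw [Real.logb_mul hrs ha, Real.logb_div ha hs]
    ring
  rw [h1, sum_mul_eq_sum_auxChannelOf hp hci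
    (fun u v x _ => Real.logb 2 ((auxChannelOf hp).a u v x / (auxChannelOf hp).source x))]
  unfold AuxChannel.sourceInfo
  simp_rw [Fintype.sum_prod_type, ← Finset.sum_mul, ← Finset.mul_sum,
    ((auxChannelOf hp).isPMF_b _ _).2, mul_one]

lemma auxChannelOf_actionInfo
    (hci : CondIndep p (fun q => q.1) (fun q => q.2.1) (fun q => q.2.2)) :
    (auxChannelOf hp).actionInfo =
    condMutualInfo p (fun q => (q.1, q.2.1)) (fun q => q.2.2.2) (fun q => q.2.2.1) := by
  have h1 : condMutualInfo p (fun q => (q.1, q.2.1)) (fun q => q.2.2.2) (fun q => q.2.2.1) =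
      ∑ q, p q * Real.logb 2 ((auxChannelOf hp).a q.2.2.1 q.2.2.2 q.1 *
        (auxChannelOf hp).b q.2.2.1 q.2.2.2 q.2.1 / (auxChannelOf hp).out q.2.2.1 q.1 q.2.1) := by
    unfold condMutualInfo
    rw [entropy_eq_neg_sum, entropy_eq_neg_sum, entropy_eq_neg_sum, entropy_eq_neg_sum,
      ← Finset.sum_neg_distrib, ← Finset.sum_neg_distrib, ← Finset.sum_neg_distrib,
      ← Finset.sum_neg_distrib, ← Finset.sum_add_distrib, ← Finset.sum_sub_distrib,
      ← Finset.sum_sub_distrib]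
    refine Finset.sum_congr rfl fun q _ => ?_
    obtain ⟨x, y, u, v⟩ := q
    dsimp only
    by_cases h0 : p (x, y, u, v) = 0
    · simp [h0]
    have hvu : probOf p (fun q => (q.2.2.2, q.2.2.1)) (v, u)
        = probOf p (fun q => q.2.2) (u, v) :=
      probOf_comp p (fun q => q.2.2) (f := Prod.swap) Prod.swap_injective (u, v)
    have hall : probOf p (fun q => ((q.1, q.2.1), q.2.2.2, q.2.2.1)) ((x, y), v, u)
        = p (x, y, u, v) := by
      rw [← probOf_id p (x, y, u, v)]
      exact probOf_comp p (fun q => q) (f := fun q => ((q.1, q.2.1), q.2.2.2, q.2.2.1))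
        (fun q q' h => by simp only [Prod.mk.injEq] at h; ext <;> tauto) (x, y, u, v)
    have hu : probOf p (fun q => q.2.2.1) u = (auxChannelOf hp).r u := rfl
    rw [hvu, hall, hu, ← auxChannelOf_r_mul_s hp, ← auxChannelOf_r_mul_out hp hci]
    rw [← auxChannelOf_joint hp hci] at h0 ⊢
    set c := auxChannelOf hp
    have hrs : c.r u * c.s u v ≠ 0 := left_ne_zero_of_mul h0
    have hr : c.r u ≠ 0 := left_ne_zero_of_mul hrs
    have hab : c.a u v x * c.b u v y ≠ 0 := right_ne_zero_of_mul h0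
    have ho : c.out u x y ≠ 0 := by
      refine (c.out_pos (v := v) ?_).ne'
      exact (mul_nonneg ((c.isPMF_s u).1 v) (mul_nonneg ((c.isPMF_a u v).1 x)
        ((c.isPMF_b u v).1 y))).lt_of_ne' (mul_ne_zero (right_ne_zero_of_mul hrs) hab)
    rw [Real.logb_mul hrs hab, Real.logb_div hab ho, Real.logb_mul hr ho]
    ring
  rw [h1, sum_mul_eq_sum_auxChannelOf hp hci (fun u v x y =>
    Real.logb 2 ((auxChannelOf hp).a u v x * (auxChannelOf hp).b u v y /
      (auxChannelOf hp).out u x y))]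
  unfold AuxChannel.actionInfo
  simp_rw [Fintype.sum_prod_type]

end auxChannelOf

/-! ### The values are bounded -/

section Bounds

variable {X Y Z : Type} [Fintype X] [Fintype Y] [Fintype Z] {R0 R : ℝ} {n : ℕ}

lemma isPMF_jointPMF [Nonempty Y] [Nonempty Z] {p0 : X → ℝ} (hp0 : IsPMF p0)
    (S : Scheme X Y Z R0 R n) (A : Adversary X Y Z R n) : IsPMF (jointPMF p0 S A) := by
  have hK : (0 : ℝ) < keyCard R0 n := by exact_mod_cast keyCard_pos R0 n
  refine ⟨fun ω => mul_nonneg (mul_nonneg (mul_nonneg (Finset.prod_nonneg fun i _ => hp0.1 _)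
    (inv_nonneg.2 hK.le)) ((S.enc_pmf _ _).1 _)) (Finset.prod_nonneg fun i _ =>
      mul_nonneg ((S.dec_pmf _ _ _ _ _ _).1 _) ((A.adv_pmf _ _ _ _ _).1 _)), ?_⟩
  have hyz : ∀ x k j, ∑ y : Fin n → Y, ∑ z : Fin n → Z,
      ∏ i, S.dec i j k x y z (y i) * A.adv i j x y z (z i) = 1 := by
    intro x k j
    have h := (causal_kernel_sum n
      (fun i (t : Fin n → Y × Z) s => S.dec i j k x (fun i => (t i).1) (fun i => (t i).2) s.1 *
        A.adv i j x (fun i => (t i).1) (fun i => (t i).2) s.2)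
      (fun i t => by
        refine ⟨fun s => mul_nonneg ((S.dec_pmf _ _ _ _ _ _).1 _) ((A.adv_pmf _ _ _ _ _).1 _), ?_⟩
        simp_rw [Fintype.sum_prod_type, ← Finset.mul_sum, (A.adv_pmf _ _ _ _ _).2, mul_one]
        exact (S.dec_pmf _ _ _ _ _ _).2)
      (fun i t t' h => by
        have h1 : ∀ m, m < i → (t m).1 = (t' m).1 := fun m hm => by rw [h m hm]
        have h2 : ∀ m, m < i → (t m).2 = (t' m).2 := fun m hm => by rw [h m hm]
        funext s
        rw [S.dec_causal i j k x _ _ x _ _ (fun _ _ => rfl) h1 h2,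
          A.adv_causal i j x _ _ x _ _ (fun _ _ => rfl) h1 h2])
      (fun _ _ => 0) (fun _ => 0) (by simp)).1
    rwa [sum_arrow_prod] at h
  unfold jointPMF
  simp_rw [Fintype.sum_prod_type, ← Finset.mul_sum, hyz, mul_one, ← Finset.mul_sum,
    (S.enc_pmf _ _).2, Finset.sum_const, Finset.card_univ, Fintype.card_fin, nsmul_eq_mul, mul_one,
    mul_assoc, inv_mul_cancel₀ hK.ne', mul_one]
  exact (IsPMF.pi fun _ : Fin n => hp0).2

lemma abs_avgValue_le [Nonempty Y] [Nonempty Z] {p0 : X → ℝ} (hp0 : IsPMF p0)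
    {π : X → Y → Z → ℝ} {M : ℝ} (hM : ∀ x y z, |π x y z| ≤ M) (hn : 0 < n)
    (S : Scheme X Y Z R0 R n) (A : Adversary X Y Z R n) : |avgValue p0 π S A| ≤ M := by
  have hj := isPMF_jointPMF hp0 S A
  have hn' : (0 : ℝ) < n := by exact_mod_cast hn
  refine (Finset.abs_sum_le_sum_abs _ _).trans ?_
  calc _ ≤ ∑ ω, jointPMF p0 S A ω * M := by
        refine Finset.sum_le_sum fun ω _ => ?_
        rw [abs_mul, abs_of_nonneg (hj.1 ω)]
        refine mul_le_mul_of_nonneg_left ?_ (hj.1 ω)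
        rw [abs_mul, abs_of_pos (inv_pos.2 hn'), inv_mul_le_iff₀ hn']
        refine (Finset.abs_sum_le_sum_abs _ _).trans ?_
        refine (Finset.sum_le_sum fun i _ => hM _ _ _).trans ?_
        simp
    _ = M := by rw [← Finset.sum_mul, hj.2, one_mul]

instance [Nonempty Z] : Nonempty (Adversary X Y Z R n) := by
  obtain ⟨z₀⟩ := ‹Nonempty Z›
  exact ⟨{ adv := fun _ _ _ _ _ z => if z = z₀ then 1 else 0
           adv_pmf := fun _ _ _ _ _ => ⟨fun _ => by dsimp only; split_ifs <;> norm_num, by simp⟩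
           adv_causal := fun _ _ _ _ _ _ _ _ _ _ _ => rfl }⟩

lemma le_robustValue_of_forall_le [Nonempty Y] [Nonempty Z] {p0 : X → ℝ} (hp0 : IsPMF p0)
    {π : X → Y → Z → ℝ} (hn : 0 < n) (S : Scheme X Y Z R0 R n) {v : ℝ}
    (hS : ∀ A : Adversary X Y Z R n, v ≤ avgValue p0 π S A) : v ≤ robustValue p0 π R0 R := by
  obtain ⟨M, hM⟩ : ∃ M, ∀ x y z, |π x y z| ≤ M := by
    obtain ⟨M, hM⟩ := (Set.finite_range fun q : X × Y × Z => |π q.1 q.2.1 q.2.2|).bddAbove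
    exact ⟨M, fun x y z => hM ⟨(x, y, z), rfl⟩⟩
  have hM' : ∀ x y z, |π x y z| ≤ max M 0 := fun x y z => (hM x y z).trans (le_max_left _ _)
  have hle : ∀ m, 0 < m → ∀ S : Scheme X Y Z R0 R m,
      ⨅ A : Adversary X Y Z R m, avgValue p0 π S A ≤ max M 0 := by
    intro m hm S
    obtain ⟨A⟩ : Nonempty (Adversary X Y Z R m) := inferInstance
    exact (ciInf_le ⟨-max M 0, by
      rintro _ ⟨A, rfl⟩
      exact (abs_le.1 (abs_avgValue_le hp0 hM' hm S A)).1⟩ A).trans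
        (abs_le.1 (abs_avgValue_le hp0 hM' hm S A)).2
  have h0 := le_max_right M 0
  unfold robustValue
  refine le_trans ?_ (le_ciSup (f := fun m : ℕ => ⨆ (_ : 0 < m) (S : Scheme X Y Z R0 R m),
    ⨅ A : Adversary X Y Z R m, avgValue p0 π S A) ⟨max M 0, ?_⟩ n)
  · refine le_trans ?_ (le_ciSup (f := fun _ : 0 < n => ⨆ S : Scheme X Y Z R0 R n,
      ⨅ A : Adversary X Y Z R n, avgValue p0 π S A) ⟨max M 0, ?_⟩ hn)
    · exact (le_ciInf hS).trans (le_ciSup (f := fun S : Scheme X Y Z R0 R n =>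
        ⨅ A : Adversary X Y Z R n, avgValue p0 π S A)
          ⟨max M 0, Set.forall_mem_range.2 (hle n hn)⟩ S)
    · exact Set.forall_mem_range.2 fun hm => Real.iSup_le (hle n hm) h0
  · exact Set.forall_mem_range.2 fun m =>
      Real.iSup_le (fun hm => Real.iSup_le (hle m hm) h0) h0

end Bounds

/-! ### Achievability of single-letter distributions -/

section SingleLetter

variable {X Y Z U V : Type} [Fintype X] [Fintype Y] [Fintype Z] [Fintype U] [Fintype V]
  {p0 : X → ℝ} {w : X → Y × U × V → ℝ}

lemma isPMF_slJoint (hp0 : IsPMF p0) (hw : ∀ x, IsPMF (w x)) : IsPMF (slJoint p0 w) := by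
  refine ⟨fun q => mul_nonneg (hp0.1 _) ((hw _).1 _), ?_⟩
  unfold slJoint
  rw [Fintype.sum_prod_type]
  simp_rw [← Finset.mul_sum, (hw _).2, mul_one]
  exact hp0.2

lemma probOf_slJoint_fst (hw : ∀ x, IsPMF (w x)) :
    probOf (slJoint p0 w) (fun q => q.1) = p0 := by
  funext x
  unfold probOf slJoint
  rw [Fintype.sum_prod_type, Finset.sum_eq_single x]
  · simp [← Finset.mul_sum, (hw x).2]
  · intro x' _ hx
    simp [hx]
  · simp

lemma exists_scheme_of_memP [Nonempty X] [Nonempty Y] [Nonempty Z] (hp0 : IsPMF p0)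
    (π : X → Y → Z → ℝ) {R0 R : ℝ} (hR0 : 0 ≤ R0) (hR : 0 ≤ R) (hw : memP p0 w R0 R)
    {ε : ℝ} (hε : 0 < ε) :
    ∃ (n : ℕ) (_ : 0 < n) (S : Scheme X Y Z R0 R n), ∀ A : Adversary X Y Z R n,
      (⨅ z : U → Z, slPayoff p0 w π z) - ε ≤ avgValue p0 π S A := by
  obtain ⟨hpmf, hci, hact, hsrc⟩ := hw
  obtain ⟨x₀⟩ := ‹Nonempty X›
  obtain ⟨_, u₀, v₀⟩ : Nonempty (Y × U × V) := by
    by_contra h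
    rw [not_nonempty_iff] at h
    simpa using (hpmf x₀).2
  have : Nonempty X := ⟨x₀⟩
  have : Nonempty U := ⟨u₀⟩
  have : Nonempty V := ⟨v₀⟩
  have hp := isPMF_slJoint hp0 hpmf
  have hsource : (auxChannelOf hp).source = p0 :=
    (funext (auxChannelOf_source hp)).trans (probOf_slJoint_fst hpmf)
  choose zs hzs using fun u : U => Finite.exists_min fun z =>
    ∑ x, ∑ y, (auxChannelOf hp).out u x y * π x y z
  obtain ⟨n, hn, S, hS⟩ := (auxChannelOf hp).exists_scheme_of_le π hR0 hR
    (by rwa [auxChannelOf_sourceInfo hp hci]) (by rwa [auxChannelOf_actionInfo hp hci]) hzs hε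
  refine ⟨n, hn, S, fun A => ?_⟩
  have hpay : slPayoff p0 w π zs
      = ∑ u, (auxChannelOf hp).r u * ∑ x, ∑ y, (auxChannelOf hp).out u x y * π x y (zs u) := by
    unfold slPayoff
    rw [sum_mul_eq_sum_auxChannelOf hp hci (fun u _ x y => π x y (zs u))]
    refine Finset.sum_congr rfl fun u _ => ?_
    rw [Finset.sum_comm, Finset.mul_sum]
    refine Finset.sum_congr rfl fun x _ => ?_
    rw [Finset.sum_comm, Finset.mul_sum]
    refine Finset.sum_congr rfl fun y _ => ?_
    unfold AuxChannel.out
    rw [Finset.sum_mul, Finset.mul_sum]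
    exact Finset.sum_congr rfl fun v _ => by ring
  have hinf : ⨅ z : U → Z, slPayoff p0 w π z ≤ slPayoff p0 w π zs :=
    ciInf_le (Set.finite_range _).bddBelow zs
  have := hS A
  rw [hsource, ← hpay] at this
  linarith

end SingleLetter

lemma nonempty_memP {X Y : Type} [Fintype X] [Fintype Y] [Nonempty Y] {p0 : X → ℝ}
    (hp0 : IsPMF p0) {R0 R : ℝ} (hR0 : 0 ≤ R0) (hR : 0 ≤ R) :
    ∃ w : X → Y × Unit × Unit → ℝ, memP p0 w R0 R := by
  obtain ⟨y₀⟩ := ‹Nonempty Y›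
  refine ⟨fun _ q => if q.1 = y₀ then 1 else 0, fun _ => ⟨fun _ => by dsimp only; split_ifs <;> norm_num,
    by
      rw [Fintype.sum_prod_type, Finset.sum_eq_single y₀] <;> simp +contextual⟩, ?_, ?_, ?_⟩
  · intro x y c
    simp [probOf, slJoint, Fintype.sum_prod_type, Prod.ext_iff, ite_and]
  · refine le_of_eq_of_le ?_ hR0
    simp [condMutualInfo, entropy, probOf, slJoint, Fintype.sum_prod_type, Prod.ext_iff, ite_and]
  · refine le_of_eq_of_le ?_ hR
    simp [mutualInfo, entropy, probOf, slJoint, Fintype.sum_prod_type, Prod.ext_iff, hp0.2]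

/-- **Achievability part of the main theorem.** `Π_{p₀}(R₀,R) ≥ Γ_{p₀,π}(R₀,R)`; equivalently,
for every finite `𝒰, 𝒱`, every `p(y,u,v|x) ∈ 𝒫_{p₀}(R₀,R)` and every `ε > 0` there is a
blocklength `n` and an `(R₀,R,n)` coordination scheme whose average value against every
adversary strategy is at least `min_{z : 𝒰 → 𝒵} E[π(X,Y,z(U))] - ε`. -/
theorem achievability_singleLetterValue_le_robustValue
    {X Y Z : Type} [Fintype X] [Fintype Y] [Fintype Z]
    [Nonempty X] [Nonempty Y] [Nonempty Z]
    (p0 : X → ℝ) (hp0 : IsPMF p0) (π : X → Y → Z → ℝ)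
    (R0 R : ℝ) (hR0 : 0 ≤ R0) (hR : 0 ≤ R) :
    Gamma p0 π R0 R ≤ robustValue p0 π R0 R ∧
    ∀ (U V : Type) (_ : Fintype U) (_ : Fintype V) (w : X → Y × U × V → ℝ),
      memP p0 w R0 R → ∀ ε : ℝ, 0 < ε →
        ∃ (n : ℕ) (_ : 0 < n) (S : Scheme X Y Z R0 R n),
          ∀ A : Adversary X Y Z R n,
            avgValue p0 π S A ≥ (⨅ z : U → Z, slPayoff p0 w π z) - ε := by
  refine ⟨csSup_le ?_ ?_, fun U V _ _ w hw ε hε => exists_scheme_of_memP hp0 π hR0 hR hw hε⟩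
  · obtain ⟨w, hw⟩ := nonempty_memP (Y := Y) hp0 hR0 hR
    exact ⟨_, Unit, Unit, inferInstance, inferInstance, w, hw, rfl⟩
  · rintro _ ⟨U, V, _, _, w, hw, rfl⟩
    refine le_of_forall_pos_le_add fun ε hε => ?_
    obtain ⟨n, hn, S, hS⟩ := exists_scheme_of_memP hp0 π hR0 hR hw hε
    exact sub_le_iff_le_add.1 (le_robustValue_of_forall_le hp0 hn S hS)

end
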